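/- Let n ≥ 1 and let M be a model of PA⁻ + IΣn. Suppose F is a Σ_{n+1}-definable (partial) injection in M whose range is bounded by some b ∈ M. Then there exists a Σn-definable function G : [0,b) × M → M such that: (1) for every s ∈ M, the map G(·,s) is injective on [0,b); (2) the domain of F equals {x ∈ M : there exists i < b with x = lim_s G(i,s)}; (3) if i < b and lim_s G(i,s) exists, then there exists s ∈ M such that G(j,t) = G(j,s) for all j ≤ i and all t > s. In particular, {i < b : lim_s G(i,s) exists} is downward closed. -/

import Mathlib

/- Shared development: first-order arithmetic in the language {0,1,+,·,<},
   the arithmetic hierarchy, fragments of arithmetic, and coded finite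
   combinatorics inside models. -/

open FirstOrder Language

namespace ArithFC

/-- Function symbols of the language of arithmetic: 0, 1, +, ·. -/
inductive Func : ℕ → Type
  | zero : Func 0
  | one : Func 0
  | add : Func 2
  | mul : Func 2

/-- Relation symbols of the language of arithmetic: <. -/
inductive Rel : ℕ → Type
  | lt : Rel 2

/-- The first-order language {0, 1, +, ·, <}. -/
def lang : Language :=
  { Functions := Func, Relations := Rel }

section Instances

variable (M : Type) [lang.Structure M]

instance : Zero M := ⟨Structure.funMap (L := lang) Func.zero ![]⟩
instance : One M := ⟨Structure.funMap (L := lang) Func.one ![]⟩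
instance : Add M := ⟨fun x y => Structure.funMap (L := lang) Func.add ![x, y]⟩
instance : Mul M := ⟨fun x y => Structure.funMap (L := lang) Func.mul ![x, y]⟩
instance : LT M := ⟨fun x y => Structure.RelMap (L := lang) Rel.lt ![x, y]⟩
instance : LE M := ⟨fun x y => x < y ∨ x = y⟩

end Instances

/-- The numeral `n` in a model. -/
def numM (M : Type) [lang.Structure M] : ℕ → M
  | 0 => 0
  | n + 1 => numM M n + 1

/-- `b` is nonstandard (greater than every numeral). -/
def Nonstd {M : Type} [lang.Structure M] (b : M) : Prop := ∀ n : ℕ, numM M n < b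

/-- The atomic formula `t < u`. -/
def ltFm {α : Type} {n : ℕ} (t u : lang.Term (α ⊕ Fin n)) : lang.BoundedFormula α n :=
  BoundedFormula.rel (Rel.lt : lang.Relations 2) ![t, u]

/-- Δ₀ formulas: built from atomic formulas by boolean connectives and
bounded universal quantification (this generates, up to logical equivalence,
the usual class of bounded formulas). -/
inductive IsDelta0 {α : Type} : ∀ n : ℕ, lang.BoundedFormula α n → Prop
  | falsum (n : ℕ) : IsDelta0 n BoundedFormula.falsum
  | equal (n : ℕ) (t u : lang.Term (α ⊕ Fin n)) : IsDelta0 n (BoundedFormula.equal t u)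
  | rel (n l : ℕ) (R : lang.Relations l) (ts : Fin l → lang.Term (α ⊕ Fin n)) :
      IsDelta0 n (BoundedFormula.rel R ts)
  | imp (n : ℕ) {φ ψ : lang.BoundedFormula α n} :
      IsDelta0 n φ → IsDelta0 n ψ → IsDelta0 n (φ.imp ψ)
  | bdAll (n : ℕ) (t : lang.Term (α ⊕ Fin n)) {φ : lang.BoundedFormula α (n + 1)} :
      IsDelta0 (n + 1) φ →
      IsDelta0 n
        (BoundedFormula.all ((ltFm (Term.var (Sum.inr (Fin.last n))) (t.liftAt 1 n)).imp φ))

mutual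
  /-- Σ_m formulas. -/
  inductive SigmaFm {α : Type} : ℕ → ∀ n : ℕ, lang.BoundedFormula α n → Prop
    | delta0 (m n : ℕ) {φ : lang.BoundedFormula α n} : IsDelta0 n φ → SigmaFm m n φ
    | ofPi (m n : ℕ) {φ : lang.BoundedFormula α n} : PiFm m n φ → SigmaFm (m + 1) n φ
    | ex (m n : ℕ) {φ : lang.BoundedFormula α (n + 1)} :
        SigmaFm (m + 1) (n + 1) φ → SigmaFm (m + 1) n φ.ex
  /-- Π_m formulas. -/
  inductive PiFm {α : Type} : ℕ → ∀ n : ℕ, lang.BoundedFormula α n → Prop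
    | delta0 (m n : ℕ) {φ : lang.BoundedFormula α n} : IsDelta0 n φ → PiFm m n φ
    | ofSigma (m n : ℕ) {φ : lang.BoundedFormula α n} : SigmaFm m n φ → PiFm (m + 1) n φ
    | all (m n : ℕ) {φ : lang.BoundedFormula α (n + 1)} :
        PiFm (m + 1) (n + 1) φ → PiFm (m + 1) n φ.all
end

/-- A `k`-ary relation on `M` is Σ_m-definable (with parameters from `M`). -/
def IsSigmaDef (m : ℕ) (M : Type) [lang.Structure M] {k : ℕ} (R : (Fin k → M) → Prop) : Prop :=
  ∃ (p : ℕ) (φ : lang.BoundedFormula (Fin k ⊕ Fin p) 0) (w : Fin p → M),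
    SigmaFm m 0 φ ∧ ∀ v : Fin k → M, R v ↔ φ.Realize (Sum.elim v w) finZeroElim

/-- A subset of `M` is Σ_m-definable with parameters. -/
def SigmaDef1 (m : ℕ) (M : Type) [lang.Structure M] (A : Set M) : Prop :=
  IsSigmaDef m M (k := 1) fun v => v 0 ∈ A

/-- A binary relation on `M` is Σ_m-definable with parameters. -/
def SigmaDef2 (m : ℕ) (M : Type) [lang.Structure M] (R : M → M → Prop) : Prop :=
  IsSigmaDef m M (k := 2) fun v => R (v 0) (v 1)

/-- A ternary relation on `M` is Σ_m-definable with parameters. -/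
def SigmaDef3 (m : ℕ) (M : Type) [lang.Structure M] (R : M → M → M → Prop) : Prop :=
  IsSigmaDef m M (k := 3) fun v => R (v 0) (v 1) (v 2)

/-- `M` is a model of PA⁻ (the nonnegative part of a discretely ordered
commutative semiring). -/
structure PAm (M : Type) [lang.Structure M] : Prop where
  add_assoc : ∀ x y z : M, x + y + z = x + (y + z)
  add_comm : ∀ x y : M, x + y = y + x
  mul_assoc : ∀ x y z : M, x * y * z = x * (y * z)
  mul_comm : ∀ x y : M, x * y = y * x
  ldistrib : ∀ x y z : M, x * (y + z) = x * y + x * z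
  add_zero : ∀ x : M, x + 0 = x
  mul_zero : ∀ x : M, x * 0 = 0
  mul_one : ∀ x : M, x * 1 = x
  lt_trans : ∀ x y z : M, x < y → y < z → x < z
  lt_irrefl : ∀ x : M, ¬x < x
  lt_total : ∀ x y : M, x < y ∨ x = y ∨ y < x
  add_lt_add : ∀ x y z : M, x < y → x + z < y + z
  mul_lt_mul : ∀ x y z : M, x < y → 0 < z → x * z < y * z
  sub_exists : ∀ x y : M, x < y → ∃ z, x + z = y
  zero_lt_one : (0 : M) < 1
  discrete : ∀ x : M, 0 < x → (1 : M) ≤ x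
  zero_le : ∀ x : M, (0 : M) ≤ x

/-- `M` satisfies the Σ_m-induction scheme (with parameters). -/
def ISig (m : ℕ) (M : Type) [lang.Structure M] : Prop :=
  ∀ A : Set M, SigmaDef1 m M A → (0 : M) ∈ A → (∀ x, x ∈ A → x + 1 ∈ A) → ∀ x, x ∈ A

/-- `M` satisfies the Σ_m-collection (bounding) scheme (with parameters). -/
def BSig (m : ℕ) (M : Type) [lang.Structure M] : Prop :=
  ∀ R : M → M → Prop, SigmaDef2 m M R → ∀ a : M,
    (∀ x, x < a → ∃ y, R x y) → ∃ b, ∀ x, x < a → ∃ y, y < b ∧ R x y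

section Coding

variable {M : Type} [lang.Structure M]

/-- `z` is the Cantor pair `⟨x, y⟩`: `2z = (x+y)(x+y+1) + 2y`. -/
def IsPairC (z x y : M) : Prop := z + z = (x + y) * (x + y + 1) + (y + y)

/-- Gödel's β-function: `x = a mod ((i+1)·b + 1)`. -/
def BetaC (a b i x : M) : Prop :=
  x < (i + 1) * b + 1 ∧ ∃ q, a = q * ((i + 1) * b + 1) + x

/-- The sequence coded by `s` (via a Cantor pair of β-function data) has value `x`
at place `i`. -/
def SeqAt (s i x : M) : Prop := ∃ a b, IsPairC s a b ∧ BetaC a b i x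

/-- `c` codes the M-finite set `X` of cardinality `card`: `c = ⟨card, s⟩` where `s`
codes the strictly increasing enumeration of `X` of length `card`. -/
def CodesFinset (c : M) (X : Set M) (card : M) : Prop :=
  ∃ s, IsPairC c card s ∧
    (∀ i, i < card → ∃ x, x ∈ X ∧ SeqAt s i x) ∧
    (∀ i j x y, i < j → j < card → SeqAt s i x → SeqAt s j y → x < y) ∧
    (∀ x, x ∈ X ↔ ∃ i, i < card ∧ SeqAt s i x)

/-- `X` is an M-finite (coded) set. -/
def MFinite (X : Set M) : Prop := ∃ c card : M, CodesFinset c X card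

/-- `d` codes an `e`-element subset `D` of `[0, y)`, i.e. an element of `[y]^e`. -/
def CodesTupleIn (d e y : M) (D : Set M) : Prop :=
  CodesFinset d D e ∧ ∀ z ∈ D, z < y

/-- `f` codes a (finite) function defined on all of `[0, a)`. -/
def CodesFunOn (f a : M) : Prop :=
  ∀ x, x < a → (∃ y, SeqAt f x y) ∧ ∀ y y', SeqAt f x y → SeqAt f x y' → y = y'

/-- `X` is an M-coded subset of `[0, a)`. -/
def MCodedSubset (a : M) (X : Set M) : Prop :=
  MFinite X ∧ ∀ x ∈ X, x < a

end Coding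

/-- An `M`-ultrafilter on `a`: an ultrafilter of the Boolean algebra of
M-finite subsets of `[0, a)`. -/
structure MUltra (M : Type) [lang.Structure M] (a : M) where
  sets : Set (Set M)
  mem_coded : ∀ X ∈ sets, MCodedSubset a X
  univ_mem : {x : M | x < a} ∈ sets
  superset_mem : ∀ X Y : Set M, X ∈ sets → MCodedSubset a Y → X ⊆ Y → Y ∈ sets
  inter_mem : ∀ X Y : Set M, X ∈ sets → Y ∈ sets → X ∩ Y ∈ sets
  empty_not_mem : (∅ : Set M) ∉ sets
  ultra : ∀ X : Set M, MCodedSubset a X → X ∈ sets ∨ {x : M | x < a ∧ x ∉ X} ∈ sets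

section Principles

variable (M : Type) [lang.Structure M]

/-- `F` is (the graph of) a Σ_m-definable injection from `[0, y)` into `[0, x)`. -/
def SigmaInjRel (m : ℕ) (F : M → M → Prop) (y x : M) : Prop :=
  SigmaDef2 m M F ∧
    (∀ u, u < y → ∃ v, v < x ∧ F u v) ∧
    (∀ u v v', u < y → F u v → F u v' → v = v') ∧
    (∀ u u' v, u < y → u' < y → F u v → F u' v → u = u')

/-- There exists a Σ_m-definable injection from `[0, y)` into `[0, x)`. -/
def ExSigmaInj (m : ℕ) (y x : M) : Prop := ∃ F : M → M → Prop, SigmaInjRel M m F y x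

/-- There exists a Σ_m-definable injection from all of `M` into `[0, a)`. -/
def SigmaInjWhole (m : ℕ) (a : M) : Prop :=
  ∃ F : M → M → Prop, SigmaDef2 m M F ∧
    (∀ u, ∃ v, v < a ∧ F u v) ∧
    (∀ u v v', F u v → F u v' → v = v') ∧
    (∀ u u' v, F u v → F u' v → u = u')

/-- CARD(Σ_m): no Σ_m-definable multivalued map sends `M` injectively below `a`. -/
def CARD (m : ℕ) : Prop :=
  ∀ F : M → M → Prop, SigmaDef2 m M F → ∀ a : M,
    (∀ x, ∃ y, y < a ∧ F x y) →
      ∃ x0 x1 y, x0 ≠ x1 ∧ y < a ∧ F x0 y ∧ F x1 y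

/-- GPHP(Σ_m): for every `x` there is `y` with no Σ_m-definable injection of
`[0,y)` into `[0,x)`. -/
def GPHP (m : ℕ) : Prop := ∀ x : M, ∃ y : M, ¬ExSigmaInj M m y x

/-- WPHP(Σ_m): for `x > 0` there is no Σ_m-definable injection of `[0,2x)` into `[0,x)`. -/
def WPHP (m : ℕ) : Prop := ∀ x : M, 0 < x → ¬ExSigmaInj M m (x + x) x

/-- `C` is a Σ_m-definable `k`-coloring of `[y]^e` (acting on codes of
`e`-element subsets of `[0,y)`, independently of the chosen code). -/
def IsColoring (m : ℕ) (e y k : M) (C : M → M → Prop) : Prop :=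
  SigmaDef2 m M C ∧
    (∀ d D, CodesTupleIn d e y D → ∃ i, i < k ∧ C d i) ∧
    (∀ d d' D i i', CodesTupleIn d e y D → CodesTupleIn d' e y D → C d i → C d' i' → i = i')

/-- FRT^e_k(Σ_m): every Σ_m-definable `k`-coloring of some `[y]^e` has an
M-finite homogeneous set of cardinality `x`, for every `x`. -/
def FRT (m : ℕ) (e k : M) : Prop :=
  ∀ x : M, ∃ y : M, ∀ C : M → M → Prop, IsColoring M m e y k C →
    ∃ (c : M) (H : Set M), CodesFinset c H x ∧ (∀ z ∈ H, z < y) ∧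
      ∃ i, ∀ d D, CodesFinset d D e → D ⊆ H → C d i

/-- fairFRT^e_k(Σ_m): the homogeneous set is required to be given as the range of a
Σ_m-definable injection from `[0,x)` into `[0,y)`. -/
def FairFRT (m : ℕ) (e k : M) : Prop :=
  ∀ x : M, ∃ y : M, ∀ C : M → M → Prop, IsColoring M m e y k C →
    ∃ H : M → M → Prop, SigmaInjRel M m H x y ∧
      ∃ i, ∀ d D, CodesFinset d D e → (∀ z ∈ D, ∃ u, u < x ∧ H u z) → C d i

/-- `C` is a Σ_m-definable `k`-coloring of `[0, y)`. -/
def IsColoring1 (m : ℕ) (y k : M) (C : M → M → Prop) : Prop :=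
  SigmaDef2 m M C ∧
    (∀ z, z < y → ∃ i, i < k ∧ C z i) ∧
    (∀ z i i', z < y → C z i → C z i' → i = i')

/-- FRT¹_k(Σ_m): every Σ_m-definable `k`-coloring of some `[0,y)` has an M-finite
homogeneous set of cardinality `x`, for every `x`. -/
def FRT1 (m : ℕ) (k : M) : Prop :=
  ∀ x : M, ∃ y : M, ∀ C : M → M → Prop, IsColoring1 M m y k C →
    ∃ (c : M) (H : Set M), CodesFinset c H x ∧ (∀ z ∈ H, z < y) ∧
      ∃ i, ∀ z ∈ H, C z i

/-- fairFRT¹_k(Σ_m). -/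
def FairFRT1 (m : ℕ) (k : M) : Prop :=
  ∀ x : M, ∃ y : M, ∀ C : M → M → Prop, IsColoring1 M m y k C →
    ∃ H : M → M → Prop, SigmaInjRel M m H x y ∧
      ∃ i, ∀ u v, u < x → H u v → C v i

end Principles

section Approx

variable {M : Type} [lang.Structure M]

/-- `f` is (the graph of) a partial function. -/
def IsPartialFun (f : M → M → Prop) : Prop := ∀ x y y', f x y → f x y' → y = y'

/-- `s` codes an approximation to the partial function `f` of length `b`. -/
def IsApprox (f : M → M → Prop) (s b : M) : Prop :=
  (∀ i, i < b → ∃ v, SeqAt s i v) ∧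
    (∀ i u v x y, i + 1 < b → SeqAt s i u → SeqAt s (i + 1) v → x ≤ u → f x y → y ≤ v)

/-- `s` codes a `g`-stretched approximation to the partial function `f` of length `b`. -/
def IsStretchedApprox (f g : M → M → Prop) (s b : M) : Prop :=
  (∀ i, i < b → ∃ v, SeqAt s i v) ∧
    (∀ i u w v x y, i + 1 < b → SeqAt s i u → g u w → SeqAt s (i + 1) v →
      x ≤ w → f x y → y ≤ v)

/-- The eventual (limit) value of `fun s => h s ·` is `x`. -/
def EvLim (h : M → M → Prop) (x : M) : Prop := ∃ s : M, ∀ t, s < t → h t x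

end Approx

/-- PΣ_m: every partial Σ_m-definable function admits approximations of every length. -/
def PSig (m : ℕ) (M : Type) [lang.Structure M] : Prop :=
  ∀ f : M → M → Prop, SigmaDef2 m M f → IsPartialFun f → ∀ b : M, ∃ s, IsApprox f s b

section Extensions

variable (M N : Type) [lang.Structure M] [lang.Structure N]

/-- `g : M → N` is Σ_m-elementary: Σ_m formulas with parameters from `M` transfer. -/
def SigmaElem (m : ℕ) (g : M → N) : Prop :=
  ∀ (p : ℕ) (φ : lang.BoundedFormula (Fin p) 0), SigmaFm m 0 φ →
    ∀ v : Fin p → M, (φ.Realize v finZeroElim ↔ φ.Realize (g ∘ v) finZeroElim)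

/-- The extension `g : M → N` is cofinal. -/
def Cofinal (g : M → N) : Prop := ∀ z : N, ∃ x : M, z ≤ g x

/-- `[0,a]^M = [0,a]^N`: every element of `N` below `g a` comes from `M`. -/
def SameBelow (g : M → N) (a : M) : Prop := ∀ z : N, z ≤ g a → ∃ x : M, g x = z

end Extensions

section Ramsey

variable {M : Type} [lang.Structure M]

/-- `f` is an M-coded `k`-coloring of `[y]^e` (assigning colors to codes of
`e`-subsets of `[0,y)`, independently of the code). -/
def CodedColoring (f e y k : M) : Prop :=
  (∀ d D, CodesTupleIn d e y D → ∃ i, i < k ∧ SeqAt f d i) ∧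
    (∀ d d' D i i', CodesTupleIn d e y D → CodesTupleIn d' e y D →
      SeqAt f d i → SeqAt f d' i' → i = i')

/-- The coded coloring `f` of `[y]^e` has an M-coded homogeneous set of cardinality `x`. -/
def CodedHomog (f e y x : M) : Prop :=
  ∃ (c : M) (H : Set M), CodesFinset c H x ∧ (∀ z ∈ H, z < y) ∧
    ∃ i, ∀ d D, CodesFinset d D e → D ⊆ H → SeqAt f d i

/-- `y = r(x, e, k)`: `y` is the least size guaranteeing coded homogeneous sets of
cardinality `x` for all coded `k`-colorings of `e`-subsets. -/
def IsRamsey (x e k y : M) : Prop :=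
  (∀ f, CodedColoring f e y k → CodedHomog f e y x) ∧
    (∀ y', y' < y → ∃ f, CodedColoring f e y' k ∧ ¬CodedHomog f e y' x)

/-- `y = r^(b)(x, e, k)`: the `b`-th iterate of the Ramsey function inside `M`. -/
def IterRamsey (x e k b y : M) : Prop :=
  ∃ s : M, SeqAt s 0 x ∧ SeqAt s b y ∧ (∀ i, i ≤ b → ∃ u, SeqAt s i u) ∧
    (∀ i u v, i < b → SeqAt s i u → SeqAt s (i + 1) v → IsRamsey u e k v)

end Ramsey

end ArithFC


set_option linter.unusedSectionVars false
set_option linter.unusedVariables false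

namespace TE

/-- Prepend an element to an environment. -/
def cons {M : Type} (x : M) (e : ℕ → M) : ℕ → M
  | 0 => x
  | i + 1 => e i

/-- Polynomial functions of an environment. -/
inductive Tm {M : Type} [Add M] [Mul M] : ((ℕ → M) → M) → Prop
  | var (i : ℕ) : Tm (fun e => e i)
  | const (c : M) : Tm (fun _ => c)
  | add {f g : (ℕ → M) → M} : Tm f → Tm g → Tm (fun e => f e + g e)
  | mul {f g : (ℕ → M) → M} : Tm f → Tm g → Tm (fun e => f e * g e)

/-- Bounded predicates of an environment. -/
inductive D0 {M : Type} [Add M] [Mul M] [LT M] : ((ℕ → M) → Prop) → Prop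
  | falsum : D0 (fun _ => False)
  | equal {f g : (ℕ → M) → M} : Tm f → Tm g → D0 (fun e => f e = g e)
  | lt {f g : (ℕ → M) → M} : Tm f → Tm g → D0 (fun e => f e < g e)
  | imp {P Q : (ℕ → M) → Prop} : D0 P → D0 Q → D0 (fun e => P e → Q e)
  | ball {t : (ℕ → M) → M} {P : (ℕ → M) → Prop} : Tm t → D0 P →
      D0 (fun e => ∀ x, x < t e → P (cons x e))

/-- Semantic Σ_m predicates of an environment. -/
inductive Sg {M : Type} [Add M] [Mul M] [LT M] : ℕ → ((ℕ → M) → Prop) → Prop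
  | d0 {m : ℕ} {P : (ℕ → M) → Prop} : D0 P → Sg m P
  | neg {m : ℕ} {P : (ℕ → M) → Prop} : Sg m P → Sg (m + 1) (fun e => ¬ P e)
  | ex {m : ℕ} {P : (ℕ → M) → Prop} : Sg (m + 1) P → Sg (m + 1) (fun e => ∃ x, P (cons x e))

section basic

variable {M : Type} [Add M] [Mul M] [LT M]

theorem Tm.subst {f : (ℕ → M) → M} (hf : Tm f) {σ : ℕ → (ℕ → M) → M} (hσ : ∀ i, Tm (σ i)) :
    Tm (fun e => f (fun i => σ i e)) := by
  induction hf with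
  | var i => exact hσ i
  | const c => exact Tm.const c
  | add _ _ h1 h2 => exact Tm.add h1 h2
  | mul _ _ h1 h2 => exact Tm.mul h1 h2

theorem Tm.tail {f : (ℕ → M) → M} (hf : Tm f) : Tm (fun e => f (fun i => e (i + 1))) :=
  hf.subst (fun i => Tm.var (i + 1))

/-- Lift a substitution under a binder. -/
def lift (σ : ℕ → (ℕ → M) → M) : ℕ → (ℕ → M) → M
  | 0 => fun e => e 0
  | i + 1 => fun e => σ i (fun j => e (j + 1))

theorem Tm.lift {σ : ℕ → (ℕ → M) → M} (hσ : ∀ i, Tm (σ i)) : ∀ i, Tm (lift σ i)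
  | 0 => Tm.var 0
  | i + 1 => (hσ i).tail

theorem cons_lift (σ : ℕ → (ℕ → M) → M) (x : M) (e : ℕ → M) :
    (fun i => lift σ i (cons x e)) = cons x (fun i => σ i e) := by
  funext i
  cases i <;> rfl

@[simp] theorem cons_eta (e : ℕ → M) : cons (e 0) (fun i => e (i + 1)) = e := by
  funext i
  cases i <;> rfl

@[simp] theorem cons_zero (x : M) (e : ℕ → M) : cons x e 0 = x := rfl

@[simp] theorem cons_succ (x : M) (e : ℕ → M) (i : ℕ) : cons x e (i + 1) = e i := rfl

theorem D0.subst {P : (ℕ → M) → Prop} (hP : D0 P) : ∀ {σ : ℕ → (ℕ → M) → M},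
    (∀ i, Tm (σ i)) → D0 (fun e => P (fun i => σ i e)) := by
  induction hP with
  | falsum => intro σ _; exact D0.falsum
  | equal hf hg => intro σ hσ; exact D0.equal (hf.subst hσ) (hg.subst hσ)
  | lt hf hg => intro σ hσ; exact D0.lt (hf.subst hσ) (hg.subst hσ)
  | imp _ _ h1 h2 => intro σ hσ; exact D0.imp (h1 hσ) (h2 hσ)
  | ball ht _ h => 
    intro σ hσ
    have := D0.ball (ht.subst hσ) (h (Tm.lift hσ))
    simpa only [cons_lift] using this

theorem Sg.subst {m : ℕ} {P : (ℕ → M) → Prop} (hP : Sg m P) : ∀ {σ : ℕ → (ℕ → M) → M},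
    (∀ i, Tm (σ i)) → Sg m (fun e => P (fun i => σ i e)) := by
  induction hP with
  | d0 h => intro σ hσ; exact Sg.d0 (h.subst hσ)
  | neg _ h => intro σ hσ; exact Sg.neg (h hσ)
  | ex _ h => 
    intro σ hσ
    have := Sg.ex (h (Tm.lift hσ))
    simpa only [cons_lift] using this

theorem Sg.tail {m : ℕ} {P : (ℕ → M) → Prop} (hP : Sg m P) :
    Sg m (fun e => P (fun i => e (i + 1))) := hP.subst (fun i => Tm.var (i + 1))

theorem Sg.succ {m : ℕ} {P : (ℕ → M) → Prop} (hP : Sg m P) : Sg (m + 1) P := by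
  induction hP with
  | d0 h => exact Sg.d0 h
  | neg _ h => exact Sg.neg h
  | ex _ h => exact Sg.ex h

theorem Sg.mono {m m' : ℕ} (h : m ≤ m') {P : (ℕ → M) → Prop} (hP : Sg m P) : Sg m' P := by
  induction h with
  | refl => exact hP
  | step _ ih => exact ih.succ

theorem Sg.congr {m : ℕ} {P Q : (ℕ → M) → Prop} (hP : Sg m P) (h : ∀ e, Q e ↔ P e) : Sg m Q := by
  have : Q = P := funext fun e => propext (h e)
  rw [this]; exact hP

theorem D0.congr {P Q : (ℕ → M) → Prop} (hP : D0 P) (h : ∀ e, Q e ↔ P e) : D0 Q := by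
  have : Q = P := funext fun e => propext (h e)
  rw [this]; exact hP

theorem D0.not {P : (ℕ → M) → Prop} (hP : D0 P) : D0 (fun e => ¬ P e) := D0.imp hP D0.falsum

theorem D0.or {P Q : (ℕ → M) → Prop} (hP : D0 P) (hQ : D0 Q) : D0 (fun e => P e ∨ Q e) :=
  (D0.imp hP.not hQ).congr (fun e => by tauto)

theorem D0.and {P Q : (ℕ → M) → Prop} (hP : D0 P) (hQ : D0 Q) : D0 (fun e => P e ∧ Q e) :=
  (hP.not.or hQ.not).not.congr (fun e => by tauto)

theorem D0.bex {t : (ℕ → M) → M} {P : (ℕ → M) → Prop} (ht : Tm t) (hP : D0 P) :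
    D0 (fun e => ∃ x, x < t e ∧ P (cons x e)) :=
  (D0.ball ht hP.not).not.congr (fun e => by push Not; rfl)

/-- Closure properties of Σ_m. -/
structure Cl (M : Type) [Add M] [Mul M] [LT M] (m : ℕ) : Prop where
  and : ∀ {P Q : (ℕ → M) → Prop}, Sg m P → Sg m Q → Sg m (fun e => P e ∧ Q e)
  or : ∀ {P Q : (ℕ → M) → Prop}, Sg m P → Sg m Q → Sg m (fun e => P e ∨ Q e)
  ball : ∀ {t : (ℕ → M) → M} {P : (ℕ → M) → Prop}, Tm t → Sg m P →
    Sg m (fun e => ∀ x, x < t e → P (cons x e))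
  bex : ∀ {t : (ℕ → M) → M} {P : (ℕ → M) → Prop}, Tm t → Sg m P →
    Sg m (fun e => ∃ x, x < t e ∧ P (cons x e))

theorem Sg.toD0 {P : (ℕ → M) → Prop} (h : Sg 0 P) : D0 P := by
  cases h; assumption

theorem Cl.zero : Cl M 0 where
  and h1 h2 := Sg.d0 (h1.toD0.and h2.toD0)
  or h1 h2 := Sg.d0 (h1.toD0.or h2.toD0)
  ball ht h := Sg.d0 (D0.ball ht h.toD0)
  bex ht h := Sg.d0 (D0.bex ht h.toD0)

end basic

section order

variable {M : Type} [CommSemiring M] [LinearOrder M] [IsStrictOrderedRing M]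
  [CanonicallyOrderedAdd M]

theorem lt_add_one' (x : M) : x < x + 1 := lt_add_one x

/-- Normal form for Σ_{m+1}. -/
theorem Sg.nf {m : ℕ} (cl : Cl M m) {P : (ℕ → M) → Prop} (hP : Sg (m + 1) P) :
    ∃ R : (ℕ → M) → Prop, Sg m R ∧ ∀ e, P e ↔ ∃ w, ¬ R (cons w e) := by
  generalize hk : m + 1 = k at hP
  induction hP with
  | @d0 k P h => 
    refine ⟨fun e => ¬ P (fun i => e (i + 1)), (Sg.d0 h.not).tail, fun e => ?_⟩
    constructor
    · intro h; exact ⟨0, not_not.2 h⟩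
    · rintro ⟨w, h⟩; exact not_not.1 h
  | @neg k P h _ => 
    obtain rfl : m = k := by omega
    refine ⟨fun e => P (fun i => e (i + 1)), h.tail, fun e => ?_⟩
    exact ⟨fun h => ⟨0, h⟩, fun ⟨w, h⟩ => h⟩
  | @ex k P _ ih =>
    obtain ⟨R, hR, h⟩ := ih hk
    let σ : ℕ → (ℕ → M) → M := fun i => match i with
      | 0 => fun e => e 0
      | 1 => fun e => e 1
      | i + 2 => fun e => e (i + 3)
    have hσ : ∀ i, Tm (σ i) := by
      intro i
      match i with
      | 0 => exact Tm.var _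
      | 1 => exact Tm.var _
      | i + 2 => exact Tm.var _
    have h2 := cl.ball (t := fun e => e 0 + 1) (Tm.add (Tm.var 0) (Tm.const 1))
      (cl.ball (t := fun e => e 1 + 1) (Tm.add (Tm.var 1) (Tm.const 1)) (hR.subst hσ))
    refine ⟨_, h2, fun e => ?_⟩
    have key : ∀ (u x w : M), (fun i => σ i (cons w (cons x (cons u e)))) = cons w (cons x e) := by
      intro u x w
      funext i
      match i with
      | 0 => rfl
      | 1 => rfl
      | i + 2 => rfl
    simp only [key, h]
    push Not
    constructor
    · rintro ⟨x, w, hw⟩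
      refine ⟨x + w, x, ?_, w, ?_, hw⟩
      · exact lt_of_le_of_lt (le_add_of_nonneg_right (zero_le)) (lt_add_one' _)
      · exact lt_of_le_of_lt (le_add_of_nonneg_left (zero_le)) (lt_add_one' _)
    · rintro ⟨u, x, _, w, _, hw⟩
      exact ⟨x, w, hw⟩

/-- Σ_n induction in the semantic setting. -/
def Ind (M : Type) [CommSemiring M] [LinearOrder M] (n : ℕ) : Prop :=
  ∀ P : (ℕ → M) → Prop, Sg n P → ∀ e : ℕ → M, P (cons 0 e) →
    (∀ x, P (cons x e) → P (cons (x + 1) e)) → ∀ x, P (cons x e)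

/-- Discreteness. -/
def Disc (M : Type) [CommSemiring M] [LinearOrder M] : Prop := ∀ x y : M, x < y + 1 → x ≤ y

theorem Cl.succ (hd : Disc M) {m n : ℕ} (hmn : m + 1 ≤ n) (hI : Ind M n) (cl : Cl M m) :
    Cl M (m + 1) where
  and {P Q} h1 h2 := by
    obtain ⟨R, hR, h1⟩ := h1.nf cl
    obtain ⟨R', hR', h2⟩ := h2.nf cl
    have a1 : Sg m (fun e => R (fun i => cons (e 1) (fun i => e (i + 2)) i)) :=
      hR.subst (σ := fun i e => cons (e 1) (fun i => e (i + 2)) i)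
        (fun i => by cases i <;> exact Tm.var _)
    have a2 : Sg m (fun e => R' (fun i => cons (e 0) (fun i => e (i + 2)) i)) :=
      hR'.subst (σ := fun i e => cons (e 0) (fun i => e (i + 2)) i)
        (fun i => by cases i <;> exact Tm.var _)
    refine (Sg.ex (Sg.ex (Sg.neg (cl.or a1 a2)))).congr fun e => ?_
    rw [h1, h2]
    constructor
    · rintro ⟨⟨w, h⟩, w', h'⟩
      exact ⟨w, w', not_or.2 ⟨h, h'⟩⟩
    · rintro ⟨w, w', h⟩
      exact ⟨⟨w, (not_or.1 h).1⟩, w', (not_or.1 h).2⟩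
  or {P Q} h1 h2 := by
    obtain ⟨R, hR, h1⟩ := h1.nf cl
    obtain ⟨R', hR', h2⟩ := h2.nf cl
    refine (Sg.ex (Sg.neg (cl.and hR hR'))).congr fun e => ?_
    rw [h1, h2]
    constructor
    · rintro (⟨w, h⟩ | ⟨w, h⟩)
      · exact ⟨w, fun h' => h h'.1⟩
      · exact ⟨w, fun h' => h h'.2⟩
    · rintro ⟨w, h⟩
      by_cases h3 : R (cons w e)
      · exact Or.inr ⟨w, fun h' => h ⟨h3, h'⟩⟩
      · exact Or.inl ⟨w, h3⟩
  ball {t P} ht h1 := by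
    obtain ⟨R, hR, h1⟩ := h1.nf cl
    let σ : ℕ → (ℕ → M) → M := fun i => match i with
      | 0 => fun e => e 0
      | 1 => fun e => e 1
      | i + 2 => fun e => e (i + 3)
    have hσ : ∀ i, Tm (σ i) := by
      intro i
      match i with
      | 0 => exact Tm.var _
      | 1 => exact Tm.var _
      | i + 2 => exact Tm.var _
    have key : ∀ (u x w : M) (e : ℕ → M),
        (fun i => σ i (cons w (cons x (cons u e)))) = cons w (cons x e) := by
      intro u x w e
      funext i
      match i with
      | 0 => rfl
      | 1 => rfl
      | i + 2 => rfl
    have h2 : ∀ {t : (ℕ → M) → M}, Tm t → Sg (m + 1) (fun e => ∃ B, ∀ x, x < t e → ∃ w, w < B ∧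
        ¬ R (cons w (cons x e))) := by
      intro t ht
      refine (Sg.ex (Sg.neg (cl.bex (t := fun e => t (fun i => e (i + 1))) ht.tail
        (cl.ball (t := fun e => e 1) (Tm.var 1) (hR.subst hσ))))).congr fun e => ?_
      simp only [key]
      push Not
      rfl
    refine (h2 ht).congr fun e => ?_
    simp only [h1]
    constructor
    · intro h
      have h3 := (h2 (t := fun e => e 0) (Tm.var 0)).mono hmn
      have a4 : Sg n (fun e => ∃ B, ∀ x, x < e 0 → ∃ w, w < B ∧ (e 0 ≤ t (fun i => e (i+1)) → ¬ R (cons w (cons x (fun i => e (i+1)))))) := by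
        refine (Sg.ex (Sg.neg (cl.bex (t := fun e => e 1) (Tm.var 1)
          (cl.ball (t := fun e => e 1) (Tm.var 1)
          (cl.and (P := fun e => e 3 ≤ t (fun i => e (i + 4))) ?_ (hR.subst (σ := fun i e => cons (e 0) (cons (e 1) (fun i => e (i + 4))) i)
           ?_)))))).mono hmn |>.congr fun e => ?_
        · refine (Sg.d0 ((D0.lt (ht.subst (σ := fun i e => e (i+4)) (fun i => Tm.var _)) (Tm.var 3)).not)).congr fun e => ?_
          exact not_lt.symm
        · intro i
          match i with
          | 0 => exact Tm.var _
          | 1 => exact Tm.var _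
          | i + 2 => exact Tm.var _
        · push Not; rfl
      have h5 := hI _ a4 e ⟨0, fun x hx => absurd hx (not_lt.2 (zero_le (a := x)))⟩ (by
        rintro c ⟨B, hB⟩
        by_cases hc : c + 1 ≤ t e
        · obtain ⟨w, hw⟩ := h c (lt_of_lt_of_le (lt_add_one' c) hc)
          refine ⟨B + w + 1, fun x hx => ?_⟩
          have hBw : w < B + w + 1 := lt_of_le_of_lt (le_add_of_nonneg_left (zero_le)) (lt_add_one' _)
          rcases (hd x c hx).lt_or_eq with hx | rfl
          · obtain ⟨w', hw', h'⟩ := hB x hx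
            exact ⟨w', hw'.trans_le ((le_add_of_nonneg_right zero_le).trans (lt_add_one' _).le), fun _ => h' ((lt_add_one' c).le.trans hc)⟩
          · exact ⟨w, hBw, fun _ => hw⟩
        · exact ⟨1, fun x _ => ⟨0, zero_lt_one, fun h => absurd h hc⟩⟩) (t e)
      obtain ⟨B, hB⟩ := h5
      exact ⟨B, fun x hx => by
        obtain ⟨w, hw, h⟩ := hB x hx
        exact ⟨w, hw, h le_rfl⟩⟩
    · rintro ⟨B, hB⟩ x hx
      obtain ⟨w, _, h⟩ := hB x hx
      exact ⟨w, h⟩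
  bex {t P} ht h1 := by
    obtain ⟨R, hR, h1⟩ := h1.nf cl
    have a1 : Sg m (fun e => ¬ (e 1 < t (fun i => e (i + 2)))) :=
      Sg.d0 (D0.lt (Tm.var 1) (ht.subst (σ := fun i e => e (i + 2)) (fun i => Tm.var _))).not
    refine (Sg.ex (Sg.ex (Sg.neg (cl.or a1 hR)))).congr fun e => ?_
    simp only [h1]
    constructor
    · rintro ⟨x, hx, w, h⟩
      exact ⟨x, w, not_or.2 ⟨not_not.2 hx, h⟩⟩
    · rintro ⟨x, w, h⟩
      exact ⟨x, not_not.1 (not_or.1 h).1, w, (not_or.1 h).2⟩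

theorem Cl.all (hd : Disc M) {n : ℕ} (hI : Ind M n) : ∀ m, m ≤ n → Cl M m
  | 0, _ => Cl.zero
  | m + 1, h => Cl.succ hd h hI (Cl.all hd hI m (Nat.le_of_succ_le h))

end order

end TE


set_option linter.unusedSectionVars false
set_option linter.unusedVariables false

namespace TE

section delta

variable {M : Type} [CommSemiring M] [LinearOrder M] [IsStrictOrderedRing M]
  [CanonicallyOrderedAdd M]

/-- The standing assumptions. -/
structure Ctx (M : Type) [CommSemiring M] [LinearOrder M] (n : ℕ) : Prop where
  disc : Disc M
  ind : Ind M n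
  pos : 1 ≤ n

/-- Δ_n predicates. -/
def Dl {M : Type} [CommSemiring M] [LinearOrder M] (n : ℕ) (P : (ℕ → M) → Prop) : Prop :=
  Sg n P ∧ Sg n (fun e => ¬ P e)

/-- Σ_n (hence Δ_n) total functions. -/
def DF {M : Type} [CommSemiring M] [LinearOrder M] (n : ℕ) (f : (ℕ → M) → M) : Prop :=
  Sg n (fun e => e 0 = f (fun i => e (i + 1)))

variable {n : ℕ}

theorem Ctx.cl (c : Ctx M n) : Cl M n := Cl.all c.disc c.ind n le_rfl

theorem Ctx.ex (c : Ctx M n) {P : (ℕ → M) → M → Prop}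
    (h : Sg n (fun e => P (fun i => e (i + 1)) (e 0))) : Sg n (fun e => ∃ x, P e x) := by
  obtain ⟨m, rfl⟩ : ∃ m, n = m + 1 := ⟨n - 1, by have := c.pos; omega⟩
  exact Sg.ex h

theorem Ctx.sand (c : Ctx M n) {P Q : (ℕ → M) → Prop} (hP : Sg n P) (hQ : Sg n Q) :
    Sg n (fun e => P e ∧ Q e) := c.cl.and hP hQ

theorem Ctx.sor (c : Ctx M n) {P Q : (ℕ → M) → Prop} (hP : Sg n P) (hQ : Sg n Q) :
    Sg n (fun e => P e ∨ Q e) := c.cl.or hP hQ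

theorem DF.tail {f : (ℕ → M) → M} (h : DF n f) : DF n (fun e => f (fun i => e (i + 1))) := by
  refine (Sg.subst (σ := fun i e => cons (e 0) (fun i => e (i + 2)) i) h ?_)
  intro i
  cases i <;> exact Tm.var _

theorem Ctx.sR4 (c : Ctx M n) {R : M → M → M → M → Prop}
    (hR : Sg n (fun e => R (e 0) (e 1) (e 2) (e 3))) {f g h k : (ℕ → M) → M}
    (hf : DF n f) (hg : DF n g) (hh : DF n h) (hk : DF n k) :
    Sg n (fun e => R (f e) (g e) (h e) (k e)) := by
  have key : ∀ {f : (ℕ → M) → M}, DF n f → ∀ j, Sg n (fun e => e j = f (fun i => e (i + 4))) := by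
    intro f hf j
    refine (Sg.subst (σ := fun i e => cons (e j) (fun i => e (i + 4)) i) hf ?_)
    intro i
    cases i <;> exact Tm.var _
  have := c.ex (P := fun e x => ∃ y z w, R x y z w ∧ x = f e ∧ y = g e ∧ z = h e ∧ w = k e)
    (c.ex (c.ex (c.ex (c.sand (hR.subst (σ := fun i e =>
      match i with
      | 0 => e 3
      | 1 => e 2
      | 2 => e 1
      | 3 => e 0
      | i + 4 => e (i + 4)) (by
        intro i
        match i with
        | 0 => exact Tm.var _
        | 1 => exact Tm.var _
        | 2 => exact Tm.var _
        | 3 => exact Tm.var _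
        | i + 4 => exact Tm.var _)) (c.sand (key hf 3) (c.sand (key hg 2) (c.sand (key hh 1) (key hk 0))))))))
  refine this.congr fun e => ?_
  constructor
  · intro h; exact ⟨_, _, _, _, h, rfl, rfl, rfl, rfl⟩
  · rintro ⟨_, _, _, _, h, rfl, rfl, rfl, rfl⟩; exact h

theorem Ctx.sR3 (c : Ctx M n) {R : M → M → M → Prop}
    (hR : Sg n (fun e => R (e 0) (e 1) (e 2))) {f g h : (ℕ → M) → M}
    (hf : DF n f) (hg : DF n g) (hh : DF n h) :
    Sg n (fun e => R (f e) (g e) (h e)) :=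
  c.sR4 (R := fun x y z _ => R x y z) hR hf hg hh hh

theorem Ctx.sR2 (c : Ctx M n) {R : M → M → Prop}
    (hR : Sg n (fun e => R (e 0) (e 1))) {f g : (ℕ → M) → M}
    (hf : DF n f) (hg : DF n g) : Sg n (fun e => R (f e) (g e)) :=
  c.sR4 (R := fun x y _ _ => R x y) hR hf hg hf hf

theorem Ctx.sR1 (c : Ctx M n) {R : M → Prop}
    (hR : Sg n (fun e => R (e 0))) {f : (ℕ → M) → M}
    (hf : DF n f) : Sg n (fun e => R (f e)) :=
  c.sR4 (R := fun x _ _ _ => R x) hR hf hf hf hf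

theorem Ctx.R4 (c : Ctx M n) {R : M → M → M → M → Prop}
    (hR : Dl n (fun e => R (e 0) (e 1) (e 2) (e 3))) {f g h k : (ℕ → M) → M}
    (hf : DF n f) (hg : DF n g) (hh : DF n h) (hk : DF n k) :
    Dl n (fun e => R (f e) (g e) (h e) (k e)) :=
  ⟨c.sR4 hR.1 hf hg hh hk, c.sR4 (R := fun x y z w => ¬ R x y z w) hR.2 hf hg hh hk⟩

theorem Ctx.R3 (c : Ctx M n) {R : M → M → M → Prop}
    (hR : Dl n (fun e => R (e 0) (e 1) (e 2))) {f g h : (ℕ → M) → M}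
    (hf : DF n f) (hg : DF n g) (hh : DF n h) :
    Dl n (fun e => R (f e) (g e) (h e)) :=
  c.R4 (R := fun x y z _ => R x y z) hR hf hg hh hh

theorem Ctx.R2 (c : Ctx M n) {R : M → M → Prop}
    (hR : Dl n (fun e => R (e 0) (e 1))) {f g : (ℕ → M) → M}
    (hf : DF n f) (hg : DF n g) : Dl n (fun e => R (f e) (g e)) :=
  c.R4 (R := fun x y _ _ => R x y) hR hf hg hf hf

theorem Ctx.R1 (c : Ctx M n) {R : M → Prop}
    (hR : Dl n (fun e => R (e 0))) {f : (ℕ → M) → M}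
    (hf : DF n f) : Dl n (fun e => R (f e)) :=
  c.R4 (R := fun x _ _ _ => R x) hR hf hf hf hf

theorem DF.of_tm {f : (ℕ → M) → M} (h : Tm f) : DF n f := Sg.d0 (D0.equal (Tm.var 0) h.tail)

theorem Ctx.var (c : Ctx M n) (i : ℕ) : DF n (fun e : ℕ → M => e i) := DF.of_tm (Tm.var i)

theorem Ctx.const (c : Ctx M n) (a : M) : DF n (fun _ : ℕ → M => a) := DF.of_tm (Tm.const a)

theorem Ctx.F3 (c : Ctx M n) {F : M → M → M → M} (hF : DF n (fun e => F (e 0) (e 1) (e 2)))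
    {f g h : (ℕ → M) → M} (hf : DF n f) (hg : DF n g) (hh : DF n h) :
    DF n (fun e => F (f e) (g e) (h e)) :=
  c.sR4 (R := fun v x y z => v = F x y z) hF (c.var 0) hf.tail hg.tail hh.tail

theorem Ctx.F2 (c : Ctx M n) {F : M → M → M} (hF : DF n (fun e => F (e 0) (e 1)))
    {f g : (ℕ → M) → M} (hf : DF n f) (hg : DF n g) :
    DF n (fun e => F (f e) (g e)) :=
  c.F3 (F := fun x y _ => F x y) hF hf hg hg

theorem Ctx.F1 (c : Ctx M n) {F : M → M} (hF : DF n (fun e => F (e 0)))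
    {f : (ℕ → M) → M} (hf : DF n f) : DF n (fun e => F (f e)) :=
  c.F3 (F := fun x _ _ => F x) hF hf hf hf

theorem Ctx.add (c : Ctx M n) {f g : (ℕ → M) → M} (hf : DF n f) (hg : DF n g) :
    DF n (fun e => f e + g e) :=
  c.F2 (F := fun x y => x + y) (DF.of_tm (Tm.add (Tm.var 0) (Tm.var 1))) hf hg

theorem Ctx.mul (c : Ctx M n) {f g : (ℕ → M) → M} (hf : DF n f) (hg : DF n g) :
    DF n (fun e => f e * g e) :=
  c.F2 (F := fun x y => x * y) (DF.of_tm (Tm.mul (Tm.var 0) (Tm.var 1))) hf hg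

theorem Dl.of_d0 {P : (ℕ → M) → Prop} (h : D0 P) : Dl n P := ⟨Sg.d0 h, Sg.d0 h.not⟩

theorem Ctx.eq (c : Ctx M n) {f g : (ℕ → M) → M} (hf : DF n f) (hg : DF n g) :
    Dl n (fun e => f e = g e) :=
  c.R2 (R := fun x y => x = y) (Dl.of_d0 (D0.equal (Tm.var 0) (Tm.var 1))) hf hg

theorem Ctx.lt (c : Ctx M n) {f g : (ℕ → M) → M} (hf : DF n f) (hg : DF n g) :
    Dl n (fun e => f e < g e) :=
  c.R2 (R := fun x y => x < y) (Dl.of_d0 (D0.lt (Tm.var 0) (Tm.var 1))) hf hg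

theorem Dl.congr {P Q : (ℕ → M) → Prop} (hP : Dl n P) (h : ∀ e, Q e ↔ P e) : Dl n Q := by
  have : Q = P := funext fun e => propext (h e)
  rw [this]; exact hP

theorem Ctx.not (c : Ctx M n) {P : (ℕ → M) → Prop} (h : Dl n P) : Dl n (fun e => ¬ P e) :=
  ⟨h.2, h.1.congr fun e => not_not⟩

theorem Ctx.and (c : Ctx M n) {P Q : (ℕ → M) → Prop} (hP : Dl n P) (hQ : Dl n Q) :
    Dl n (fun e => P e ∧ Q e) :=
  ⟨c.sand hP.1 hQ.1, (c.sor hP.2 hQ.2).congr fun e => by tauto⟩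

theorem Ctx.or (c : Ctx M n) {P Q : (ℕ → M) → Prop} (hP : Dl n P) (hQ : Dl n Q) :
    Dl n (fun e => P e ∨ Q e) :=
  ⟨c.sor hP.1 hQ.1, (c.sand hP.2 hQ.2).congr fun e => by tauto⟩

theorem Ctx.imp (c : Ctx M n) {P Q : (ℕ → M) → Prop} (hP : Dl n P) (hQ : Dl n Q) :
    Dl n (fun e => P e → Q e) := (c.or (c.not hP) hQ).congr fun e => by tauto

theorem Ctx.le (c : Ctx M n) {f g : (ℕ → M) → M} (hf : DF n f) (hg : DF n g) :
    Dl n (fun e => f e ≤ g e) := (c.not (c.lt hg hf)).congr fun e => not_lt.symm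

theorem Ctx.sball (c : Ctx M n) {f : (ℕ → M) → M} {P : (ℕ → M) → M → Prop} (hf : DF n f)
    (h : Sg n (fun e => P (fun i => e (i + 1)) (e 0))) :
    Sg n (fun e => ∀ x, x < f e → P e x) := by
  have h1 : Sg n (fun e => P (fun i => e (i + 2)) (e 0)) :=
    h.subst (σ := fun i e => cons (e 0) (fun i => e (i + 2)) i) (by
      intro i; cases i <;> exact Tm.var _)
  have := c.ex (P := fun e y => y = f e ∧ ∀ x, x < y → P e x) (c.sand hf
    (c.cl.ball (t := fun e => e 0) (Tm.var 0) h1))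
  refine this.congr fun e => ?_
  constructor
  · intro h; exact ⟨_, rfl, h⟩
  · rintro ⟨_, rfl, h⟩; exact h

theorem Ctx.sbex (c : Ctx M n) {f : (ℕ → M) → M} {P : (ℕ → M) → M → Prop} (hf : DF n f)
    (h : Sg n (fun e => P (fun i => e (i + 1)) (e 0))) :
    Sg n (fun e => ∃ x, x < f e ∧ P e x) :=
  c.ex (c.sand (c.lt (c.var 0) hf.tail).1 h)

theorem Ctx.ball (c : Ctx M n) {f : (ℕ → M) → M} {P : (ℕ → M) → M → Prop} (hf : DF n f)
    (h : Dl n (fun e => P (fun i => e (i + 1)) (e 0))) :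
    Dl n (fun e => ∀ x, x < f e → P e x) :=
  ⟨c.sball hf h.1, (c.sbex (P := fun e x => ¬ P e x) hf h.2).congr fun e => by push Not; rfl⟩

theorem Ctx.bex (c : Ctx M n) {f : (ℕ → M) → M} {P : (ℕ → M) → M → Prop} (hf : DF n f)
    (h : Dl n (fun e => P (fun i => e (i + 1)) (e 0))) :
    Dl n (fun e => ∃ x, x < f e ∧ P e x) :=
  ⟨c.sbex hf h.1, (c.sball (P := fun e x => ¬ P e x) hf h.2).congr fun e => by push Not; rfl⟩

theorem Ctx.sind (c : Ctx M n) {P : M → Prop} (h : Sg n (fun e => P (e 0))) (h0 : P 0)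
    (hs : ∀ x, P x → P (x + 1)) : ∀ x, P x :=
  c.ind _ h (fun _ => 0) h0 hs

theorem Ctx.dind (c : Ctx M n) {P : M → Prop} (h : Dl n (fun e => P (e 0))) (h0 : P 0)
    (hs : ∀ x, P x → P (x + 1)) : ∀ x, P x := c.sind h.1 h0 hs

theorem Ctx.le_of (c : Ctx M n) {x y : M} (h : x < y + 1) : x ≤ y := c.disc x y h

theorem Ctx.succ_le (c : Ctx M n) {x y : M} (h : x < y) : x + 1 ≤ y := by
  by_contra h1
  exact absurd (c.le_of (not_le.1 h1)) (not_le.2 h)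

theorem Ctx.lt_succ (c : Ctx M n) {x y : M} : x < y + 1 ↔ x ≤ y :=
  ⟨c.le_of, fun h => lt_of_le_of_lt h (lt_add_one y)⟩

theorem Ctx.least (c : Ctx M n) {P : M → Prop} (h : Dl n (fun e => P (e 0))) (hex : ∃ x, P x) :
    ∃ x, P x ∧ ∀ y, y < x → ¬ P y := by
  by_contra hc
  push Not at hc
  have : ∀ x, ∀ y, y < x → ¬ P y := by
    refine c.dind (P := fun x => ∀ y, y < x → ¬ P y) (c.ball (c.var 0) (c.not h)) ?_ ?_
    · intro y hy; exact absurd hy (not_lt.2 zero_le)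
    · intro x ih y hy hP
      rcases (c.le_of hy).lt_or_eq with h1 | rfl
      · exact ih y h1 hP
      · obtain ⟨z, hz, hz'⟩ := hc y hP
        exact ih z hz hz'
  obtain ⟨x, hx⟩ := hex
  exact this (x + 1) x (lt_add_one x) hx

theorem Ctx.ite (c : Ctx M n) {P : (ℕ → M) → Prop} [∀ e, Decidable (P e)] {f g : (ℕ → M) → M}
    (hP : Dl n P) (hf : DF n f) (hg : DF n g) : DF n (fun e => if P e then f e else g e) := by
  have hP' : Dl n (fun e => P (fun i => e (i + 1))) := ⟨hP.1.tail, hP.2.tail⟩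
  refine (c.sor (c.sand hP'.1 hf) (c.sand hP'.2 hg)).congr fun e => ?_
  by_cases h : P (fun i => e (i + 1)) <;> simp [h]

/-- bounded increasing sequences stabilise -/
theorem Ctx.stab_mono (c : Ctx M n) {T : M → M} (hT : DF n (fun e => T (e 0))) (s0 B : M)
    (hm : ∀ s t, s0 ≤ s → s ≤ t → T s ≤ T t) (hB : ∀ t, s0 ≤ t → T t ≤ B) :
    ∃ s, s0 ≤ s ∧ ∀ t, s ≤ t → T t = T s := by
  by_contra hc
  push Not at hc
  have : ∀ v, ∃ t, s0 ≤ t ∧ v ≤ T t := by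
    refine c.sind (P := fun v => ∃ t, s0 ≤ t ∧ v ≤ T t) (c.ex (c.and (c.le (c.const _) (c.var 0))
      (c.le (c.var 1) (c.F1 hT (c.var 0)))).1) ⟨s0, le_rfl, zero_le⟩ ?_
    rintro v ⟨t, ht, hv⟩
    obtain ⟨t', ht', hne⟩ := hc t ht
    refine ⟨t', ht.trans ht', ?_⟩
    exact c.succ_le (lt_of_le_of_lt hv (lt_of_le_of_ne (hm t t' ht ht') (Ne.symm hne)))
  obtain ⟨t, ht, h⟩ := this (B + 1)
  exact absurd (h.trans (hB t ht)) (not_le.2 (lt_add_one B))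

/-- decreasing sequences stabilise -/
theorem Ctx.stab_anti (c : Ctx M n) {T : M → M} (hT : DF n (fun e => T (e 0))) (s0 : M)
    (hm : ∀ s t, s0 ≤ s → s ≤ t → T t ≤ T s) :
    ∃ s, s0 ≤ s ∧ ∀ t, s ≤ t → T t = T s := by
  by_contra hc
  push Not at hc
  have : ∀ v, ∃ t, s0 ≤ t ∧ T t + v ≤ T s0 := by
    refine c.sind (P := fun v => ∃ t, s0 ≤ t ∧ T t + v ≤ T s0) (c.ex (c.and (c.le (c.const _) (c.var 0))
      (c.le (c.add (c.F1 hT (c.var 0)) (c.var 1)) (c.const _))).1) ⟨s0, le_rfl, by simp⟩ ?_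
    rintro v ⟨t, ht, hv⟩
    obtain ⟨t', ht', hne⟩ := hc t ht
    refine ⟨t', ht.trans ht', ?_⟩
    have := c.succ_le (lt_of_le_of_ne (hm t t' ht ht') hne)
    calc T t' + (v + 1) = T t' + 1 + v := by ring
      _ ≤ T t + v := by gcongr
      _ ≤ _ := hv
  obtain ⟨t, ht, h⟩ := this (T s0 + 1)
  have h2 : T s0 + 1 ≤ T t + (T s0 + 1) := le_add_of_nonneg_left zero_le
  exact absurd (h2.trans h) (not_le.2 (lt_add_one _))

end delta

end TE


set_option linter.unusedSectionVars false
set_option linter.unusedVariables false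

namespace TE

section coding

variable {M : Type} [CommSemiring M] [LinearOrder M] [IsStrictOrderedRing M]
  [CanonicallyOrderedAdd M] {n : ℕ}

theorem Dl.sg {P : (ℕ → M) → Prop} (h : Dl n P) : Sg n P := h.1

/-- The moduli of the β-function. -/
def md (d i : M) : M := (i + 1) * d + 1

/-- The β-function, as a bounded relation. -/
def Be (a d i v : M) : Prop := v < md d i ∧ ∃ q, q < a + 1 ∧ a = q * md d i + v

theorem Ctx.div_unique (c : Ctx M n) {m q q' v w : M} (hv : v < m) (hw : w < m)
    (h : q * m + v = q' * m + w) : q = q' ∧ v = w := by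
  have aux : ∀ {q q' v w : M}, v < m → q * m + v = q' * m + w → ¬ q < q' := by
    intro q q' v w hv h hlt
    have h1 : (q + 1) * m ≤ q' * m := by gcongr; exact c.succ_le hlt
    have h2 : q * m + m ≤ q * m + v := by
      calc q * m + m = (q + 1) * m := by ring
        _ ≤ q' * m := h1
        _ ≤ q' * m + w := le_add_of_nonneg_right zero_le
        _ = _ := h.symm
    exact absurd (le_of_add_le_add_left h2) (not_le.2 hv)
  have hq : q = q' := le_antisymm (not_lt.1 (aux hw h.symm)) (not_lt.1 (aux hv h))
  subst hq
  exact ⟨rfl, add_left_cancel h⟩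

theorem Be.unique (c : Ctx M n) {a d i v w : M} (h1 : Be a d i v) (h2 : Be a d i w) : v = w := by
  obtain ⟨hv, q, _, h⟩ := h1
  obtain ⟨hw, q', _, h'⟩ := h2
  exact (c.div_unique hv hw (h.symm.trans h')).2

theorem md_pos (d i : M) : 1 ≤ md d i := le_add_of_nonneg_left zero_le

theorem Be.mk {a d i v q : M} (hv : v < md d i) (h : a = q * md d i + v) : Be a d i v := by
  refine ⟨hv, q, lt_of_le_of_lt ?_ (lt_add_one a), h⟩
  calc q = q * 1 := (mul_one q).symm
    _ ≤ q * md d i := by gcongr; exact md_pos d i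
    _ ≤ _ := by rw [h]; exact le_add_of_nonneg_right zero_le

theorem Be.le {a d i v : M} (h : Be a d i v) : v < a + 1 := by
  obtain ⟨hv, q, _, h⟩ := h
  refine lt_of_le_of_lt ?_ (lt_add_one a)
  rw [h]; exact le_add_of_nonneg_left zero_le

/-- invertibility -/
def Cop (a m : M) : Prop := ∃ u v, a * u = 1 + m * v

theorem Cop.mul {a b m : M} (ha : Cop a m) (hb : Cop b m) : Cop (a * b) m := by
  obtain ⟨u, v, h⟩ := ha
  obtain ⟨u', v', h'⟩ := hb
  refine ⟨u * u', v + v' + m * v * v', ?_⟩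
  calc a * b * (u * u') = (a * u) * (b * u') := by ring
    _ = _ := by rw [h, h']; ring

theorem cop_md {d e i r : M} (hd : d = r * e) (he : 1 ≤ e) : Cop (md d i) (md d (i + r)) := by
  obtain ⟨X, hX⟩ : ∃ X, X = md d i * (i + r + 1) ^ 2 * e := ⟨_, rfl⟩
  have h1 : X + 1 = md d (i + r) * ((i + r + 1) * (i + 1) * e + 1) := by
    rw [hX, md, md, hd]; ring
  have h2 : 1 ≤ X := by
    rw [hX]
    have h3 : (1 : M) ≤ i + r + 1 := le_add_of_nonneg_left zero_le
    calc (1 : M) = 1 * 1 ^ 2 * 1 := by ring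
      _ ≤ _ := by gcongr; exact md_pos d i
  obtain ⟨X', hX'⟩ := exists_add_of_le h2
  refine ⟨(i + r + 1) ^ 2 * e * X, ((i + r + 1) * (i + 1) * e + 1) * X', ?_⟩
  calc md d i * ((i + r + 1) ^ 2 * e * X) = X * X := by rw [hX]; ring
    _ = 1 + (X + 1) * X' := by rw [hX']; ring
    _ = _ := by rw [h1]; ring

theorem crt {a L m r : M} (hm : 1 ≤ m) (h : Cop L m) : ∃ t q, a + L * t = q * m + r := by
  obtain ⟨u, v, h⟩ := h
  obtain ⟨m0, hm0⟩ := exists_add_of_le hm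
  refine ⟨u * (r + a * m0), a + v * (r + a * m0), ?_⟩
  calc a + L * (u * (r + a * m0)) = a + (L * u) * (r + a * m0) := by ring
    _ = a + (1 + m * v) * (r + a * m0) := by rw [h]
    _ = a * (1 + m0) + r + m * v * (r + a * m0) := by ring
    _ = _ := by rw [← hm0]; ring

theorem Ctx.be (c : Ctx M n) {f g h k : (ℕ → M) → M}
    (hf : DF n f) (hg : DF n g) (hh : DF n h) (hk : DF n k) :
    Dl n (fun e => Be (f e) (g e) (h e) (k e)) := by
  refine c.R4 (R := Be) ?_ hf hg hh hk
  unfold Be md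
  apply_rules [c.and, c.lt, c.eq, c.add, c.mul, c.bex, c.var, c.const]

theorem Ctx.good (c : Ctx M n) (B : M) : ∀ N : M, ∃ d, (1 ≤ d ∧ B ≤ d) ∧
    ∀ x, x < N → ∃ e, e < d + 1 ∧ d = (x + 1) * e := by
  refine c.sind (P := fun N => ∃ d, (1 ≤ d ∧ B ≤ d) ∧
    ∀ x, x < N → ∃ e, e < d + 1 ∧ d = (x + 1) * e) ?_ ?_ ?_
  · refine c.ex (Dl.sg ?_)
    apply_rules [c.and, c.lt, c.le, c.eq, c.add, c.mul, c.ball, c.bex, c.var,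
      c.const]
  · exact ⟨B + 1, ⟨le_add_of_nonneg_left zero_le, (lt_add_one B).le⟩,
      fun x hx => absurd hx (not_lt.2 zero_le)⟩
  · rintro N ⟨d, ⟨h1, hB⟩, h⟩
    have hN : 1 ≤ N + 1 := le_add_of_nonneg_left zero_le
    have hdN : d ≤ d * (N + 1) := le_mul_of_one_le_right zero_le hN
    refine ⟨d * (N + 1), ⟨h1.trans hdN, hB.trans hdN⟩, fun x hx => ?_⟩
    rcases (c.le_of hx).lt_or_eq with h2 | rfl
    · obtain ⟨e, he, h3⟩ := h x h2
      refine ⟨e * (N + 1), ?_, by rw [h3]; ring⟩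
      rw [c.lt_succ] at he ⊢
      gcongr
    · exact ⟨d, c.lt_succ.2 hdN, by ring⟩

/-- `(a, d)` codes the partial sums of `f p q` up to `k`. -/
def Tr (f : M → M → M → M) (p q a d k : M) : Prop :=
  Be a d 0 0 ∧ ∀ j, j < k → ∃ v, v < a + 1 ∧ (Be a d j v ∧ Be a d (j + 1) (v + f p q j))

theorem Ctx.tr (c : Ctx M n) {f : M → M → M → M} (hf : DF n (fun e => f (e 0) (e 1) (e 2)))
    {p q a d k : (ℕ → M) → M} (hp : DF n p) (hq : DF n q) (ha : DF n a) (hd : DF n d)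
    (hk : DF n k) : Dl n (fun e => Tr f (p e) (q e) (a e) (d e) (k e)) := by
  refine c.and (c.be ha hd (c.const _) (c.const _)) (c.ball hk (c.bex (c.add ha.tail (c.const _))
    (c.and (c.be ha.tail.tail hd.tail.tail (c.var _) (c.var _)) (c.be ha.tail.tail hd.tail.tail
      (c.add (c.var _) (c.const _)) (c.add (c.var _) (c.F3 hf hp.tail.tail hq.tail.tail (c.var _)))))))

theorem Ctx.bdd (c : Ctx M n) {f : M → M} (hf : DF n (fun e => f (e 0))) :
    ∀ k : M, ∃ B, ∀ j, j < k → f j ≤ B := by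
  refine c.sind (P := fun k => ∃ B, ∀ j, j < k → f j ≤ B)
    (c.ex (c.ball (c.var _) (c.le (c.F1 hf (c.var _)) (c.var _))).1) ?_ ?_
  · exact ⟨0, fun x hx => absurd hx (not_lt.2 zero_le)⟩
  · rintro k ⟨B, h⟩
    refine ⟨max B (f k), fun j hj => ?_⟩
    rcases (c.le_of hj).lt_or_eq with h2 | rfl
    · exact (h j h2).trans (le_max_left _ _)
    · exact le_max_right _ _

theorem Be.shift {a d i v L t : M} (h : Be a d i v) (hL : ∃ x, x < L + 1 ∧ L = x * md d i) :
    Be (a + L * t) d i v := by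
  obtain ⟨hv, q, _, h⟩ := h
  obtain ⟨x, _, hx⟩ := hL
  exact Be.mk (q := q + x * t) hv (by
    calc a + L * t = (q * md d i + v) + (x * md d i) * t := by rw [← h, ← hx]
      _ = _ := by ring)

theorem Ctx.tr_exists (c : Ctx M n) {f : M → M → M → M}
    (hf : DF n (fun e => f (e 0) (e 1) (e 2))) (p q k : M) :
    ∃ a d v, Tr f p q a d k ∧ Be a d k v := by
  obtain ⟨B, hB⟩ := c.bdd (f := fun j => f p q j) (c.F3 hf (c.const p) (c.const q) (c.var 0)) k
  obtain ⟨d, ⟨hd1, hdB⟩, hd⟩ := c.good (k * B) k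
  have hcop : ∀ i j, i < j → j < k + 1 → Cop (md d i) (md d j) := by
    intro i j hij hj
    obtain ⟨r, rfl⟩ := exists_add_of_le (c.succ_le hij)
    have hr : r < k := by
      have h1 : i + 1 + r ≤ k := c.le_of hj
      refine lt_of_lt_of_le (lt_add_one r) (le_trans ?_ h1)
      calc r + 1 ≤ i + (r + 1) := le_add_of_nonneg_left zero_le
        _ = _ := by ring
    obtain ⟨e, _, he⟩ := hd r hr
    have he1 : 1 ≤ e := by
      by_contra h
      have h0 : e = 0 := le_antisymm (c.le_of (by simpa using h)) zero_le
      rw [h0, mul_zero] at he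
      rw [he] at hd1
      exact absurd hd1 (not_le.2 zero_lt_one)
    have := cop_md (i := i) he he1
    rwa [show i + 1 + r = i + (r + 1) by ring]
  have main : ∀ j, k < j ∨ ∃ a L v, (Tr f p q a d j ∧ Be a d j v ∧ v ≤ j * B) ∧
      (∀ i, i < j + 1 → ∃ x, x < L + 1 ∧ L = x * md d i) ∧
      ∀ i, i < k + 1 → i ≤ j ∨ Cop L (md d i) := by
    refine c.sind (P := fun j => k < j ∨ ∃ a L v, (Tr f p q a d j ∧ Be a d j v ∧ v ≤ j * B) ∧
      (∀ i, i < j + 1 → ∃ x, x < L + 1 ∧ L = x * md d i) ∧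
      ∀ i, i < k + 1 → i ≤ j ∨ Cop L (md d i)) ?_ ?_ ?_
    · refine c.sor (c.lt (c.const _) (c.var _)).1 (c.ex (c.ex (c.ex (c.sand ?_ (c.sand ?_ ?_)))))
      · exact (c.and (c.tr hf (c.const _) (c.const _) (c.var _) (c.const _) (c.var _)) (c.and
          (c.be (c.var _) (c.const _) (c.var _) (c.var _))
          (c.le (c.var _) (c.mul (c.var _) (c.const _))))).1
      · unfold md
        apply Dl.sg
        apply_rules [c.and, c.lt, c.le, c.eq, c.add, c.mul, c.ball, c.bex, c.var,
          c.const]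
      · refine c.sball (c.const _) (c.sor (c.le (c.var _) (c.var _)).1 (c.ex (c.ex (Dl.sg ?_))))
        unfold md
        apply_rules [c.and, c.lt, c.le, c.eq, c.add, c.mul, c.ball, c.bex, c.var,
          c.const]
    · right
      have hb : Be (0 : M) d 0 0 := Be.mk (q := 0) (lt_of_lt_of_le zero_lt_one (md_pos d 0)) (by ring)
      refine ⟨0, md d 0, 0, ⟨⟨hb, fun j hj => absurd hj (not_lt.2 zero_le)⟩, hb, zero_le⟩, ?_, ?_⟩
      · intro i hi
        have h0 : i = 0 := le_antisymm (c.le_of hi) zero_le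
        subst h0
        exact ⟨1, c.lt_succ.2 (md_pos d 0), (one_mul _).symm⟩
      · intro i hi
        rcases (zero_le (a := i)).lt_or_eq with h | h
        · exact Or.inr (hcop 0 i h hi)
        · exact Or.inl h.symm.le
    · rintro j (hj | ⟨a, L, v, ⟨⟨h0, htr⟩, hv, hvB⟩, hL, hC⟩)
      · exact Or.inl (hj.trans (lt_add_one j))
      by_cases hjk : k < j + 1
      · exact Or.inl hjk
      right
      rw [not_lt] at hjk
      have hjk' : j < k := lt_of_lt_of_le (lt_add_one j) hjk
      have hvB' : v + f p q j ≤ (j + 1) * B := by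
        calc v + f p q j ≤ j * B + B := add_le_add hvB (hB j hjk')
          _ = _ := by ring
      have hlt : v + f p q j < md d (j + 1) := by
        calc v + f p q j ≤ (j + 1) * B := hvB'
          _ ≤ k * B := by gcongr
          _ ≤ d := hdB
          _ ≤ (j + 1 + 1) * d := le_mul_of_one_le_left zero_le (le_add_of_nonneg_left zero_le)
          _ < _ := lt_add_one _
      have hCj : Cop L (md d (j + 1)) := (hC (j + 1) (c.lt_succ.2 hjk)).resolve_left
        (not_le.2 (lt_add_one j))
      obtain ⟨t, x, hx⟩ := crt (a := a) (r := v + f p q j) (md_pos d (j + 1)) hCj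
      have hnew : Be (a + L * t) d (j + 1) (v + f p q j) := Be.mk hlt hx
      have hsh : ∀ i w, i ≤ j → Be a d i w → Be (a + L * t) d i w := fun i w hi h =>
        h.shift (hL i (c.lt_succ.2 hi))
      refine ⟨a + L * t, L * md d (j + 1), v + f p q j, ⟨⟨hsh 0 0 zero_le h0, ?_⟩, hnew, hvB'⟩, ?_, ?_⟩
      · intro i hi
        rcases (c.le_of hi).lt_or_eq with h | rfl
        · obtain ⟨w, _, h1, h2⟩ := htr i h
          have h3 := hsh i w h.le h1
          exact ⟨w, h3.le, h3, hsh (i + 1) _ (c.succ_le h) h2⟩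
        · have h3 := hsh i v le_rfl hv
          exact ⟨v, h3.le, h3, hnew⟩
      · intro i hi
        rcases (c.le_of hi).lt_or_eq with h | rfl
        · obtain ⟨x, hx, h1⟩ := hL i h
          refine ⟨x * md d (j + 1), ?_, by
            calc L * md d (j + 1) = (x * md d i) * md d (j + 1) := by rw [← h1]
              _ = _ := by ring⟩
          rw [c.lt_succ] at hx ⊢
          gcongr
        · exact ⟨L, c.lt_succ.2 (le_mul_of_one_le_right zero_le (md_pos _ _)), rfl⟩
      · intro i hi
        rcases hC i hi with h | h
        · exact Or.inl (h.trans (lt_add_one j).le)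
        · by_cases h2 : i ≤ j + 1
          · exact Or.inl h2
          · exact Or.inr (h.mul (hcop _ _ (not_le.1 h2) hi))
  rcases main k with h | ⟨a, L, v, ⟨h1, h2, _⟩, _⟩
  · exact absurd h (lt_irrefl k)
  · exact ⟨a, d, v, h1, h2⟩

theorem Ctx.tr_unique (c : Ctx M n) {f : M → M → M → M}
    (hf : DF n (fun e => f (e 0) (e 1) (e 2))) {p q k a d v a' d' v' : M}
    (h : Tr f p q a d k) (h' : Tr f p q a' d' k) (hv : Be a d k v) (hv' : Be a' d' k v') :
    v = v' := by
  have main : ∀ j, j ≤ k → ∀ v, v < a + 1 → ∀ v', v' < a' + 1 → Be a d j v → Be a' d' j v' →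
      v = v' := by
    refine c.dind (P := fun j => j ≤ k → ∀ v, v < a + 1 → ∀ v', v' < a' + 1 → Be a d j v →
      Be a' d' j v' → v = v') ?_ ?_ ?_
    · apply_rules [c.imp, c.be, c.lt, c.le, c.eq, c.ball, c.var, c.const]
    · intro _ v _ v' _ h1 h2
      rw [h1.unique c h.1, h2.unique c h'.1]
    · intro j ih hj v _ v' _ h1 h2
      have hjk : j < k := lt_of_lt_of_le (lt_add_one j) hj
      obtain ⟨w, hw, h3, h4⟩ := h.2 j hjk
      obtain ⟨w', hw', h3', h4'⟩ := h'.2 j hjk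
      rw [h1.unique c h4, h2.unique c h4', ih hjk.le w hw w' hw' h3 h3']
  exact main k le_rfl v hv.le v' hv'.le hv hv'

open Classical in
/-- the sum of `f p q j` for `j < k` -/
noncomputable def Sum (f : M → M → M → M) (p q k : M) : M :=
  if h : ∃ v a d, Tr f p q a d k ∧ Be a d k v then h.choose else 0

theorem Ctx.sum_spec (c : Ctx M n) {f : M → M → M → M}
    (hf : DF n (fun e => f (e 0) (e 1) (e 2))) (p q k : M) :
    ∃ a d, Tr f p q a d k ∧ Be a d k (Sum f p q k) := by
  have h : ∃ v a d, Tr f p q a d k ∧ Be a d k v := by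
    obtain ⟨a, d, v, h⟩ := c.tr_exists hf p q k
    exact ⟨v, a, d, h⟩
  rw [Sum, dif_pos h]
  exact h.choose_spec

theorem Ctx.sum_eq (c : Ctx M n) {f : M → M → M → M}
    (hf : DF n (fun e => f (e 0) (e 1) (e 2))) {p q k a d v : M}
    (h : Tr f p q a d k) (hv : Be a d k v) : Sum f p q k = v := by
  obtain ⟨a', d', h1, h2⟩ := c.sum_spec hf p q k
  exact c.tr_unique hf h1 h h2 hv

theorem Ctx.sum_def (c : Ctx M n) {f : M → M → M → M}
    (hf : DF n (fun e => f (e 0) (e 1) (e 2))) : DF n (fun e => Sum f (e 0) (e 1) (e 2)) := by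
  have : Sg n (fun e => ∃ a d, Tr f (e 1) (e 2) a d (e 3) ∧ Be a d (e 3) (e 0)) :=
    c.ex (c.ex (c.and (c.tr hf (c.var _) (c.var _) (c.var _) (c.var _) (c.var _))
      (c.be (c.var _) (c.var _) (c.var _) (c.var _))).1)
  refine this.congr fun e => ?_
  constructor
  · intro h
    rw [h]
    exact c.sum_spec hf _ _ _
  · rintro ⟨a, d, h, h'⟩
    exact (c.sum_eq hf h h').symm

theorem Ctx.sum_zero (c : Ctx M n) {f : M → M → M → M}
    (hf : DF n (fun e => f (e 0) (e 1) (e 2))) (p q : M) : Sum f p q 0 = 0 := by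
  obtain ⟨a, d, h1, h2⟩ := c.sum_spec hf p q 0
  exact h2.unique c h1.1

theorem Ctx.sum_succ (c : Ctx M n) {f : M → M → M → M}
    (hf : DF n (fun e => f (e 0) (e 1) (e 2))) (p q k : M) :
    Sum f p q (k + 1) = Sum f p q k + f p q k := by
  obtain ⟨a, d, h1, h2⟩ := c.sum_spec hf p q (k + 1)
  obtain ⟨v, _, h3, h4⟩ := h1.2 k (lt_add_one k)
  rw [h2.unique c h4, c.sum_eq hf (k := k) ⟨h1.1, fun j hj => h1.2 j (hj.trans (lt_add_one k))⟩ h3]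

theorem Ctx.sum_le (c : Ctx M n) {f : M → M → M → M}
    (hf : DF n (fun e => f (e 0) (e 1) (e 2))) {p q p' q' k : M}
    (h : ∀ j, j < k → f p q j ≤ f p' q' j) : ∀ j, j ≤ k → Sum f p q j ≤ Sum f p' q' j := by
  have hS := c.sum_def hf
  refine c.dind (P := fun j => j ≤ k → Sum f p q j ≤ Sum f p' q' j) ?_ ?_ ?_
  · exact c.imp (c.le (c.var _) (c.const _)) (c.le (c.F3 hS (c.const _) (c.const _) (c.var _))
      (c.F3 hS (c.const _) (c.const _) (c.var _)))
  · intro _; rw [c.sum_zero hf, c.sum_zero hf]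
  · intro j ih hj
    have hjk : j < k := lt_of_lt_of_le (lt_add_one j) hj
    rw [c.sum_succ hf, c.sum_succ hf]
    exact add_le_add (ih hjk.le) (h j hjk)

theorem Ctx.sum_eq_imp (c : Ctx M n) {f : M → M → M → M}
    (hf : DF n (fun e => f (e 0) (e 1) (e 2))) {p q p' q' k : M}
    (h : ∀ j, j < k → f p q j ≤ f p' q' j) (he : Sum f p q k = Sum f p' q' k) :
    ∀ j, j < k → f p q j = f p' q' j := by
  have hS := c.sum_def hf
  have main : ∀ j, j ≤ k → Sum f p q j = Sum f p' q' j → ∀ i, i < j → f p q i = f p' q' i := by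
    refine c.dind (P := fun j => j ≤ k → Sum f p q j = Sum f p' q' j →
      ∀ i, i < j → f p q i = f p' q' i) ?_ ?_ ?_
    · exact c.imp (c.le (c.var _) (c.const _)) (c.imp (c.eq (c.F3 hS (c.const _) (c.const _) (c.var _))
        (c.F3 hS (c.const _) (c.const _) (c.var _))) (c.ball (c.var _)
          (c.eq (c.F3 hf (c.const _) (c.const _) (c.var _))
        (c.F3 hf (c.const _) (c.const _) (c.var _)))))
    · intro _ _ i hi; exact absurd hi (not_lt.2 zero_le)
    · intro j ih hj he
      have hjk : j < k := lt_of_lt_of_le (lt_add_one j) hj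
      rw [c.sum_succ hf, c.sum_succ hf] at he
      have h1 := c.sum_le hf h j hjk.le
      have h2 := h j hjk
      have h3 : Sum f p q j = Sum f p' q' j ∧ f p q j = f p' q' j := by
        constructor <;> grind
      intro i hi
      rcases (c.le_of hi).lt_or_eq with h4 | rfl
      · exact ih hjk.le h3.1 i h4
      · exact h3.2
  exact main k le_rfl he

theorem Ctx.sum_bound (c : Ctx M n) {f : M → M → M → M}
    (hf : DF n (fun e => f (e 0) (e 1) (e 2))) {p q k B : M}
    (h : ∀ j, j < k → f p q j ≤ B) : Sum f p q k ≤ k * B := by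
  have hS := c.sum_def hf
  have : ∀ j, j ≤ k → Sum f p q j ≤ j * B := by
    refine c.dind (P := fun j => j ≤ k → Sum f p q j ≤ j * B) ?_ ?_ ?_
    · exact c.imp (c.le (c.var _) (c.const _)) (c.le (c.F3 hS (c.const _) (c.const _) (c.var _))
        (c.mul (c.var _) (c.const _)))
    · intro _; rw [c.sum_zero hf]; exact zero_le
    · intro j ih hj
      have hjk : j < k := lt_of_lt_of_le (lt_add_one j) hj
      rw [c.sum_succ hf]
      calc _ ≤ j * B + B := add_le_add (ih hjk.le) (h j hjk)
        _ = _ := by ring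
  exact this k le_rfl

theorem Ctx.sum_one (c : Ctx M n) {f : M → M → M → M}
    (hf : DF n (fun e => f (e 0) (e 1) (e 2))) {p q k : M}
    (h : ∀ j, j < k → f p q j = 1) : Sum f p q k = k := by
  have hS := c.sum_def hf
  have : ∀ j, j ≤ k → Sum f p q j = j := by
    refine c.dind (P := fun j => j ≤ k → Sum f p q j = j) ?_ ?_ ?_
    · exact c.imp (c.le (c.var _) (c.const _)) (c.eq (c.F3 hS (c.const _) (c.const _) (c.var _))
        (c.var _))
    · intro _; rw [c.sum_zero hf]
    · intro j ih hj
      have hjk : j < k := lt_of_lt_of_le (lt_add_one j) hj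
      rw [c.sum_succ hf, ih hjk.le, h j hjk]
  exact this k le_rfl

theorem Ctx.sum_insert (c : Ctx M n) {f : M → M → M → M}
    (hf : DF n (fun e => f (e 0) (e 1) (e 2))) {p q p' q' k y : M} (hy : y < k)
    (h : ∀ j, j < k → j ≠ y → f p q j = f p' q' j) (hye : f p' q' y = f p q y + 1) :
    Sum f p' q' k = Sum f p q k + 1 := by
  have hS := c.sum_def hf
  have : ∀ j, j ≤ k → (j ≤ y → Sum f p' q' j = Sum f p q j) ∧
      (y < j → Sum f p' q' j = Sum f p q j + 1) := by
    refine c.dind (P := fun j => j ≤ k → (j ≤ y → Sum f p' q' j = Sum f p q j) ∧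
      (y < j → Sum f p' q' j = Sum f p q j + 1)) ?_ ?_ ?_
    · have h1 : ∀ p q : M, DF n (fun e => Sum f p q (e 0)) := fun p q =>
        c.F3 hS (c.const _) (c.const _) (c.var _)
      exact c.imp (c.le (c.var _) (c.const _)) (c.and
        (c.imp (c.le (c.var _) (c.const _)) (c.eq (h1 _ _) (h1 _ _)))
        (c.imp (c.lt (c.const _) (c.var _)) (c.eq (h1 _ _) (c.add (h1 _ _) (c.const _)))))
    · intro _
      refine ⟨fun _ => by rw [c.sum_zero hf, c.sum_zero hf], fun h => absurd h (not_lt.2 zero_le)⟩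
    · intro j ih hj
      have hjk : j < k := lt_of_lt_of_le (lt_add_one j) hj
      obtain ⟨ih1, ih2⟩ := ih hjk.le
      rw [c.sum_succ hf, c.sum_succ hf]
      constructor
      · intro h1
        have h2 : j < y := lt_of_lt_of_le (lt_add_one j) h1
        rw [ih1 h2.le, h j hjk h2.ne]
      · intro h1
        rcases (c.le_of h1).lt_or_eq with h2 | rfl
        · rw [ih2 h2, h j hjk h2.ne']; ring
        · rw [ih1 le_rfl, hye]; ring
  exact (this k le_rfl).2 hy

end coding

end TE


set_option linter.unusedSectionVars false
set_option linter.unusedVariables false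

namespace TE

section rank

variable {M : Type} [CommSemiring M] [LinearOrder M] [IsStrictOrderedRing M]
  [CanonicallyOrderedAdd M] {n : ℕ}

theorem Ctx.rank (c : Ctx M n) {h : M → M → M} (hh : DF n (fun e => h (e 0) (e 1)))
    (hm : ∀ y s t, s ≤ t → h y s ≤ h y t) (b : M) :
    ∃ Q : M → M → M, DF n (fun e => Q (e 0) (e 1)) ∧
      (∀ i s, i < b → ∃ y, y < b ∧ Q i s = h y s * b + y) ∧
      (∀ i j s, i < j → j < b → Q i s < Q j s) ∧
      (∀ i s t, i < b → s ≤ t → Q i s ≤ Q i t) ∧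
      (∀ y s0, y < b → (∀ t, s0 ≤ t → h y t = h y s0) →
        ∃ i, i < b ∧ ∃ s1, s0 ≤ s1 ∧ ∀ t, s1 ≤ t → Q i t = h y s0 * b + y) := by
  obtain ⟨K, hK⟩ : ∃ K : M → M → M, ∀ y s, K y s = h y s * b + y := ⟨_, fun _ _ => rfl⟩
  have hKd : DF n (fun e => K (e 0) (e 1)) := by
    simp only [hK]
    exact c.add (c.mul hh (c.const _)) (c.var _)
  have hKinj : ∀ y y' s, y < b → y' < b → K y s = K y' s → y = y' := by
    intro y y' s hy hy' h1
    rw [hK, hK] at h1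
    exact (c.div_unique hy hy' h1).2
  have hKm : ∀ y s t, s ≤ t → K y s ≤ K y t := by
    intro y s t hst
    rw [hK, hK]
    have := hm y s t hst
    gcongr
  obtain ⟨f, hf⟩ : ∃ f : M → M → M → M, ∀ k s y, f k s y = if K y s < k then 1 else 0 :=
    ⟨fun k s y => if K y s < k then 1 else 0, fun _ _ _ => rfl⟩
  have hfd : DF n (fun e => f (e 0) (e 1) (e 2)) := by
    simp only [hf]
    exact c.ite (c.lt (c.F2 hKd (c.var _) (c.var _)) (c.var _)) (c.const _) (c.const _)
  obtain ⟨C, hC⟩ : ∃ C : M → M → M, ∀ k s, C k s = Sum f k s b := ⟨_, fun _ _ => rfl⟩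
  have hCd : DF n (fun e => C (e 0) (e 1)) := by
    simp only [hC]
    exact c.F3 (c.sum_def hfd) (c.var _) (c.var _) (c.const _)
  have hfle : ∀ k s y, f k s y ≤ 1 := by
    intro k s y; rw [hf]; split_ifs
    · exact le_rfl
    · exact zero_le
  have Cmono : ∀ k k' s, k ≤ k' → C k s ≤ C k' s := by
    intro k k' s hk
    rw [hC, hC]
    refine c.sum_le hfd (k := b) (fun j hj => ?_) b le_rfl
    rw [hf, hf]
    split_ifs with h1 h2
    · exact le_rfl
    · exact absurd (h1.trans_le hk) h2
    · exact zero_le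
    · exact le_rfl
  have Canti : ∀ k s t, s ≤ t → C k t ≤ C k s := by
    intro k s t hst
    rw [hC, hC]
    refine c.sum_le hfd (k := b) (fun j hj => ?_) b le_rfl
    rw [hf, hf]
    split_ifs with h1 h2
    · exact le_rfl
    · exact absurd ((hKm j s t hst).trans_lt h1) h2
    · exact zero_le
    · exact le_rfl
  have Cins : ∀ y s, y < b → C (K y s + 1) s = C (K y s) s + 1 := by
    intro y s hy
    rw [hC, hC]
    refine c.sum_insert hfd hy (fun j hj hne => ?_) ?_
    · rw [hf, hf]
      have : K j s < K y s ↔ K j s < K y s + 1 := by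
        rw [c.lt_succ]
        exact ⟨le_of_lt, fun h1 => lt_of_le_of_ne h1 fun h2 => hne (hKinj _ _ _ hj hy h2)⟩
      simp only [this]
    · rw [hf, hf, if_pos (lt_add_one _), if_neg (lt_irrefl _), zero_add]
  have Cle : ∀ k s, C k s ≤ b := by
    intro k s
    rw [hC]
    have := c.sum_bound hfd (p := k) (q := s) (k := b) (B := 1) (fun j _ => hfle _ _ _)
    rwa [mul_one] at this
  have Clt : ∀ y s, y < b → C (K y s) s < b := by
    intro y s hy
    refine lt_of_lt_of_le (lt_add_one _) ?_
    rw [← Cins y s hy]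
    exact Cle _ _
  have C0 : ∀ s, C 0 s = 0 := by
    intro s
    refine le_antisymm ?_ zero_le
    rw [hC]
    have := c.sum_bound hfd (p := 0) (q := s) (k := b) (B := 0) (fun j _ => by
      rw [hf, if_neg (not_lt.2 zero_le)])
    rwa [mul_zero] at this
  have nx : ∀ k s, C k s < b → ∃ y, y < b ∧ C (K y s) s = C k s := by
    intro k s hk
    by_cases hex : ∃ k', k ≤ k' ∧ ∃ y, y < b ∧ K y s = k'
    · obtain ⟨k', ⟨h1, y, hy, h2⟩, h3⟩ := c.least (P := fun k' => k ≤ k' ∧ ∃ y, y < b ∧ K y s = k')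
        (c.and (c.le (c.const _) (c.var _)) (c.bex (c.const _)
          (c.eq (c.F2 hKd (c.var _) (c.const _)) (c.var _)))) hex
      refine ⟨y, hy, le_antisymm ?_ (Cmono _ _ _ (h2 ▸ h1))⟩
      rw [hC, hC]
      refine c.sum_le hfd (k := b) (fun j hj => ?_) b le_rfl
      rw [hf, hf]
      split_ifs with h4 h5
      · exact le_rfl
      · exact absurd ⟨not_lt.1 h5, j, hj, rfl⟩ (h3 (K j s) (h2 ▸ h4))
      · exact zero_le
      · exact le_rfl
    · exfalso
      have : C k s = b := by
        rw [hC]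
        refine c.sum_one hfd fun j hj => ?_
        rw [hf, if_pos]
        by_contra h1
        exact hex ⟨_, not_lt.1 h1, j, hj, rfl⟩
      exact absurd hk (by rw [this]; exact lt_irrefl _)
  have ex : ∀ s i, i < b → ∃ y, y < b ∧ C (K y s) s = i := by
    intro s
    refine c.dind (P := fun i => i < b → ∃ y, y < b ∧ C (K y s) s = i) ?_ ?_ ?_
    · exact c.imp (c.lt (c.var _) (c.const _)) (c.bex (c.const _) (c.eq
        (c.F2 hCd (c.F2 hKd (c.var _) (c.const _)) (c.const _)) (c.var _)))
    · intro h0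
      have := nx 0 s (by rwa [C0])
      rwa [C0] at this
    · intro i ih hi
      obtain ⟨y, hy, h1⟩ := ih ((lt_add_one i).trans hi)
      have h2 : C (K y s + 1) s = i + 1 := by rw [Cins y s hy, h1]
      have := nx _ s (h2.symm ▸ hi)
      rwa [h2] at this
  have Clt2 : ∀ y y' s, y < b → K y s < K y' s → C (K y s) s < C (K y' s) s := by
    intro y y' s hy h1
    refine lt_of_lt_of_le (lt_add_one _) ?_
    rw [← Cins y s hy]
    exact Cmono _ _ _ (c.succ_le h1)
  have uniq : ∀ y y' s, y < b → y' < b → C (K y s) s = C (K y' s) s → y = y' := by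
    intro y y' s hy hy' h1
    refine hKinj _ _ s hy hy' (le_antisymm (not_lt.1 fun h2 => ?_) (not_lt.1 fun h2 => ?_))
    · exact absurd (Clt2 _ _ _ hy' h2) (by rw [h1]; exact lt_irrefl _)
    · exact absurd (Clt2 _ _ _ hy h2) (by rw [h1]; exact lt_irrefl _)
  have hQ0 : ∀ i s, ∃ v, (i < b ∧ ∃ y, y < b ∧ (v = K y s ∧ C (K y s) s = i)) ∨ (¬ i < b ∧ v = 0) := by
    intro i s
    by_cases hi : i < b
    · obtain ⟨y, hy, h1⟩ := ex s i hi
      exact ⟨_, Or.inl ⟨hi, y, hy, rfl, h1⟩⟩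
    · exact ⟨0, Or.inr ⟨hi, rfl⟩⟩
  choose Q hQ using hQ0
  have hQs : ∀ i s, i < b → ∃ y, y < b ∧ (Q i s = K y s ∧ C (K y s) s = i) := by
    intro i s hi
    rcases hQ i s with h1 | h1
    · exact h1.2
    · exact absurd hi h1.1
  have hQu : ∀ y s, y < b → Q (C (K y s) s) s = K y s := by
    intro y s hy
    obtain ⟨y', hy', h1, h2⟩ := hQs _ s (Clt y s hy)
    rw [h1, uniq _ _ _ hy' hy h2]
  refine ⟨Q, ?_, ?_, ?_, ?_, ?_⟩
  · have : Sg n (fun e => (e 1 < b ∧ ∃ y, y < b ∧ (e 0 = K y (e 2) ∧ C (K y (e 2)) (e 2) = e 1)) ∨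
        (¬ e 1 < b ∧ e 0 = 0)) := Dl.sg (c.or (c.and (c.lt (c.var _) (c.const _)) (c.bex (c.const _)
          (c.and (c.eq (c.var _) (c.F2 hKd (c.var _) (c.var _)))
          (c.eq (c.F2 hCd (c.F2 hKd (c.var _) (c.var _)) (c.var _)) (c.var _)))))
          (c.and (c.not (c.lt (c.var _) (c.const _))) (c.eq (c.var _) (c.const _))))
    refine this.congr fun e => ?_
    constructor
    · intro h1
      rw [h1]
      exact hQ _ _
    · rintro (⟨h1, y, hy, h2, h3⟩ | ⟨h1, h2⟩)
      · rw [h2]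
        show _ = Q (e 1) (e 2)
        rw [← h3, hQu _ _ hy]
      · rcases hQ (e 1) (e 2) with h3 | h3
        · exact absurd h3.1 h1
        · rw [h2]; exact h3.2.symm
  · intro i s hi
    obtain ⟨y, hy, h1, _⟩ := hQs i s hi
    exact ⟨y, hy, by rw [h1, hK]⟩
  · intro i j s hij hj
    obtain ⟨y, hy, h1, h2⟩ := hQs i s (hij.trans hj)
    obtain ⟨y', hy', h1', h2'⟩ := hQs j s hj
    by_contra hlt
    rw [h1, h1', not_lt] at hlt
    have := Cmono _ _ s hlt
    rw [h2, h2'] at this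
    exact absurd hij (not_lt.2 this)
  · intro i s t hi hst
    obtain ⟨y, hy, h1, h2⟩ := hQs i s hi
    obtain ⟨y', hy', h1', h2'⟩ := hQs i t hi
    by_contra hlt
    rw [h1, h1', not_le] at hlt
    have h3 := Cins y' t hy'
    rw [h2'] at h3
    have h4 := Canti (K y' t + 1) s t hst
    have h5 := Cmono _ _ s (c.succ_le hlt)
    rw [h2] at h5
    rw [h3] at h4
    exact absurd (h4.trans h5) (not_le.2 (lt_add_one i))
  · intro y s0 hy hst
    obtain ⟨s1, h1, h2⟩ := c.stab_anti (T := fun t => C (K y s0) t)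
      (c.F2 hCd (c.const _) (c.var _)) s0 (fun s t _ hst => Canti _ _ _ hst)
    have hKt : ∀ t, s1 ≤ t → K y t = K y s0 := fun t ht => by rw [hK, hK, hst t (h1.trans ht)]
    refine ⟨C (K y s0) s1, ?_, s1, h1, ?_⟩
    · rw [← hKt s1 le_rfl]; exact Clt _ _ hy
    · intro t ht
      have := hQu y t hy
      rw [hKt t ht] at this
      rw [← hK, ← h2 t ht]
      exact this

end rank

end TE


set_option linter.unusedSectionVars false
set_option linter.unusedVariables false

namespace TE

section main

variable {M : Type} [CommSemiring M] [LinearOrder M] [IsStrictOrderedRing M]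
  [CanonicallyOrderedAdd M] {n : ℕ}

/-- a pairing function -/
def pr (x z : M) : M := (x + z) * (x + z) + x

theorem pr_left (x z : M) : x ≤ pr x z := le_add_of_nonneg_left zero_le

theorem Ctx.pr_right (c : Ctx M n) (x z : M) : z ≤ pr x z := by
  have h0 : ∀ w : M, w ≤ w * w := by
    intro w
    rcases (zero_le (a := w)).lt_or_eq with h | h
    · have h1 := c.succ_le h
      rw [zero_add] at h1
      exact le_mul_of_one_le_right zero_le h1
    · rw [← h, mul_zero]
  calc z ≤ x + z := le_add_of_nonneg_left zero_le
    _ ≤ (x + z) * (x + z) := h0 _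
    _ ≤ _ := le_add_of_nonneg_right zero_le

theorem Ctx.pr_inj (c : Ctx M n) {x z x' z' : M} (h : pr x z = pr x' z') : x = x' ∧ z = z' := by
  have aux : ∀ {x z x' z' : M}, pr x z = pr x' z' → ¬ x + z < x' + z' := by
    intro x z x' z' h hlt
    have h1 := c.succ_le hlt
    have h2 : pr x z < pr x' z' := by
      calc pr x z ≤ (x + z) * (x + z) + (x + z) := by
            unfold pr
            gcongr
            exact le_add_of_nonneg_right zero_le
        _ ≤ (x + z) * (x + z) + (x + z) + (x + z) := le_add_of_nonneg_right zero_le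
        _ < (x + z) * (x + z) + (x + z) + (x + z) + 1 := lt_add_one _
        _ = (x + z + 1) * (x + z + 1) := by ring
        _ ≤ (x' + z') * (x' + z') := by gcongr
        _ ≤ _ := le_add_of_nonneg_right zero_le
    exact absurd h h2.ne
  have hs : x + z = x' + z' := le_antisymm (not_lt.1 (aux h.symm)) (not_lt.1 (aux h))
  have hx : x = x' := by
    unfold pr at h
    rw [hs] at h
    exact add_left_cancel h
  subst hx
  exact ⟨rfl, add_left_cancel hs⟩

theorem Ctx.pr (c : Ctx M n) {f g : (ℕ → M) → M} (hf : DF n f) (hg : DF n g) :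
    DF n (fun e => TE.pr (f e) (g e)) :=
  c.add (c.mul (c.add hf hg) (c.add hf hg)) hf

theorem Ctx.main (c : Ctx M n) (b : M) (F : M → M → Prop) (S : M → M → M → M → Prop)
    (hS : Dl n (fun e => S (e 0) (e 1) (e 2) (e 3)))
    (hFS : ∀ x y, F x y ↔ ∃ z, ∀ u, S x y z u)
    (hFfun : ∀ x y y', F x y → F x y' → y = y')
    (hFinj : ∀ x x' y, F x y → F x' y → x = x')
    (hFbd : ∀ x y, F x y → y < b) :
    ∃ G : M → M → M → Prop, Sg n (fun e => G (e 0) (e 1) (e 2)) ∧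
      (∀ i s : M, i < b → ∃! v, G i s v) ∧
      (∀ s i i' v : M, i < b → i' < b → G i s v → G i' s v → i = i') ∧
      (∀ x : M, (∃ y, F x y) ↔ ∃ i, i < b ∧ ∃ s, ∀ t, s < t → G i t x) ∧
      (∀ i x : M, i < b → (∃ s, ∀ t, s < t → G i t x) →
        ∃ s : M, ∀ j, j ≤ i → ∀ t, s < t → ∀ v w, G j s v → G j t w → v = w) ∧
      (∀ i j : M, j ≤ i → i < b → (∃ x, ∃ s, ∀ t, s < t → G i t x) →
        ∃ x, ∃ s, ∀ t, s < t → G j t x) := by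
  -- approximations
  obtain ⟨D', hD'⟩ : ∃ D' : M → M → M → Prop, ∀ p y u, D' p y u ↔
      ∃ x, x < p + 1 ∧ ∃ z, z < p + 1 ∧ (p = TE.pr x z ∧ S x y z u) := ⟨_, fun _ _ _ => Iff.rfl⟩
  have hD'd : Dl n (fun e => D' (e 0) (e 1) (e 2)) := by
    simp only [hD']
    exact c.bex (c.add (c.var _) (c.const _)) (c.bex (c.add (c.var _) (c.const _))
      (c.and (c.eq (c.var _) (c.pr (c.var _) (c.var _)))
      (c.R4 hS (c.var _) (c.var _) (c.var _) (c.var _))))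
  obtain ⟨A, hA⟩ : ∃ A : M → M → M → Prop, ∀ y s p, A y s p ↔
      (p = s ∨ ∀ u, u < s → D' p y u) := ⟨_, fun _ _ _ => Iff.rfl⟩
  have hAd : Dl n (fun e => A (e 0) (e 1) (e 2)) := by
    simp only [hA]
    exact c.or (c.eq (c.var _) (c.var _)) (c.ball (c.var _) (c.R3 hD'd (c.var _) (c.var _) (c.var _)))
  have hAs : ∀ y s, A y s s := fun y s => (hA _ _ _).2 (Or.inl rfl)
  have hl : ∀ y s, ∃ p, A y s p ∧ ∀ q, q < p → ¬ A y s q := fun y s =>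
    c.least (c.R3 hAd (c.const _) (c.const _) (c.var _)) ⟨s, hAs y s⟩
  choose h hh1 hh2 using hl
  have hle : ∀ y s p, A y s p → h y s ≤ p := fun y s p hp => not_lt.1 fun h1 => hh2 y s p h1 hp
  have hd : DF n (fun e => h (e 0) (e 1)) := by
    have : Sg n (fun e => A (e 1) (e 2) (e 0) ∧ ∀ q, q < e 0 → ¬ A (e 1) (e 2) q) := Dl.sg
      (c.and (c.R3 hAd (c.var _) (c.var _) (c.var _)) (c.ball (c.var _)
        (c.not (c.R3 hAd (c.var _) (c.var _) (c.var _)))))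
    refine this.congr fun e => ?_
    constructor
    · intro h1
      rw [h1]
      exact ⟨hh1 _ _, hh2 _ _⟩
    · rintro ⟨h1, h2⟩
      exact le_antisymm (not_lt.1 fun h3 => h2 _ h3 (hh1 _ _)) (hle _ _ _ h1)
  have hmono : ∀ y s t, s ≤ t → h y s ≤ h y t := by
    intro y s t hst
    rcases (hA _ _ _).1 (hh1 y t) with h1 | h1
    · rw [h1]
      exact (hle _ _ _ (hAs y s)).trans hst
    · exact hle _ _ _ ((hA _ _ _).2 (Or.inr fun u hu => h1 u (hu.trans_le hst)))
  have hvalid : ∀ y t0, (∀ t, t0 ≤ t → h y t = h y t0) → ∃ x z, h y t0 = TE.pr x z ∧ F x y := by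
    intro y t0 h1
    have h2 : ∀ u, D' (h y t0) y u := by
      intro u
      obtain ⟨t, ht⟩ : ∃ t, t = t0 + (u + 1) + (h y t0 + 1) := ⟨_, rfl⟩
      have h3 := hh1 y t
      rw [h1 t (by
        rw [ht, add_assoc]; exact le_add_of_nonneg_right zero_le)] at h3
      rcases (hA _ _ _).1 h3 with h4 | h4
      · exfalso
        have h5 : h y t0 < t := by
          rw [ht]
          exact lt_of_lt_of_le (lt_add_one _) (le_add_of_nonneg_left zero_le)
        exact h5.ne h4
      · refine h4 u (lt_of_lt_of_le (lt_add_one u) ?_)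
        rw [ht]
        exact (le_add_of_nonneg_left zero_le).trans (le_add_of_nonneg_right zero_le)
    obtain ⟨x, hx, z, hz, h3, h4⟩ := (hD' _ _ _).1 (h2 0)
    refine ⟨x, z, h3, (hFS x y).2 ⟨z, fun u => ?_⟩⟩
    obtain ⟨x', hx', z', hz', h3', h4'⟩ := (hD' _ _ _).1 (h2 u)
    obtain ⟨rfl, rfl⟩ := c.pr_inj (h3.symm.trans h3')
    exact h4'
  have hvalid2 : ∀ x y, F x y → ∃ s0, ∀ t, s0 ≤ t → h y t = h y s0 := by
    intro x y hF
    obtain ⟨z, hz⟩ := (hFS x y).1 hF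
    obtain ⟨s, _, h1⟩ := c.stab_mono (T := fun t => h y t) (c.F2 hd (c.const _) (c.var _)) 0
      (TE.pr x z) (fun s t _ hst => hmono y s t hst) (fun t _ => hle _ _ _ ((hA _ _ _).2 (Or.inr
        fun u _ => (hD' _ _ _).2 ⟨x, c.lt_succ.2 (pr_left _ _), z, c.lt_succ.2 (c.pr_right _ _),
          rfl, hz u⟩)))
    exact ⟨s, h1⟩
  obtain ⟨Q, hQd, hQ1, hQ2, hQ3, hQ4⟩ := c.rank hd hmono b
  -- guesses
  obtain ⟨g, hg⟩ : ∃ g : M → M → M → Prop, ∀ i s x, g i s x ↔ (Q i s = Q i (s + 1) ∧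
      ∃ y, y < b ∧ ∃ p, p < s + 1 ∧ ∃ z, z < p + 1 ∧ (Q i s = p * b + y ∧ p = TE.pr x z)) :=
    ⟨_, fun _ _ _ => Iff.rfl⟩
  have hgd : Dl n (fun e => g (e 0) (e 1) (e 2)) := by
    simp only [hg]
    exact c.and (c.eq (c.F2 hQd (c.var _) (c.var _)) (c.F2 hQd (c.var _) (c.add (c.var _) (c.const _))))
      (c.bex (c.const _) (c.bex (c.add (c.var _) (c.const _)) (c.bex (c.add (c.var _) (c.const _))
        (c.and (c.eq (c.F2 hQd (c.var _) (c.var _)) (c.add (c.mul (c.var _) (c.const _)) (c.var _)))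
          (c.eq (c.var _) (c.pr (c.var _) (c.var _)))))))
  have hgu : ∀ i s x x', g i s x → g i s x' → x = x' := by
    intro i s x x' h1 h2
    obtain ⟨_, y, hy, p, _, z, _, h3, h4⟩ := (hg _ _ _).1 h1
    obtain ⟨_, y', hy', p', _, z', _, h3', h4'⟩ := (hg _ _ _).1 h2
    obtain ⟨rfl, rfl⟩ := c.div_unique hy hy' (h3.symm.trans h3')
    exact (c.pr_inj (h4.symm.trans h4')).1
  have hgb : ∀ i s x, g i s x → x < s + 1 := by
    intro i s x h1
    obtain ⟨_, y, hy, p, hp, z, _, h3, h4⟩ := (hg _ _ _).1 h1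
    exact lt_of_le_of_lt (by rw [h4]; exact pr_left _ _) hp
  obtain ⟨E, hE⟩ : ∃ E : M → M → M → Prop, ∀ i s x, E i s x ↔ (g i s x ∧ ∀ j, j < i → ¬ g j s x) :=
    ⟨_, fun _ _ _ => Iff.rfl⟩
  have hEd : Dl n (fun e => E (e 0) (e 1) (e 2)) := by
    simp only [hE]
    exact c.and hgd (c.ball (c.var _) (c.not (c.R3 hgd (c.var _) (c.var _) (c.var _))))
  obtain ⟨G, hG⟩ : ∃ G : M → M → M → Prop, ∀ i s v, G i s v ↔ (E i s v ∨
      ((¬ ∃ x, x < s + 1 ∧ E i s x) ∧ v = s + 1 + i)) := ⟨_, fun _ _ _ => Iff.rfl⟩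
  have hGd : Sg n (fun e => G (e 0) (e 1) (e 2)) := by
    simp only [hG]
    exact Dl.sg (c.or hEd (c.and (c.not (c.bex (c.add (c.var _) (c.const _))
      (c.R3 hEd (c.var _) (c.var _) (c.var _)))) (c.eq (c.var _)
        (c.add (c.add (c.var _) (c.const _)) (c.var _)))))
  have hEb : ∀ i s x, E i s x → x < s + 1 := fun i s x h1 => hgb i s x ((hE _ _ _).1 h1).1
  have hGu : ∀ i s v w, G i s v → G i s w → v = w := by
    intro i s v w hv hw
    rcases (hG _ _ _).1 hv with h1 | ⟨h1, rfl⟩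
    · rcases (hG _ _ _).1 hw with h2 | ⟨h2, rfl⟩
      · exact hgu _ _ _ _ ((hE _ _ _).1 h1).1 ((hE _ _ _).1 h2).1
      · exact absurd ⟨v, hEb _ _ _ h1, h1⟩ h2
    · rcases (hG _ _ _).1 hw with h2 | ⟨h2, rfl⟩
      · exact absurd ⟨w, hEb _ _ _ h2, h2⟩ h1
      · rfl
  have hGex : ∀ i s, ∃ v, G i s v := by
    intro i s
    by_cases h1 : ∃ x, x < s + 1 ∧ E i s x
    · obtain ⟨x, _, hx⟩ := h1
      exact ⟨x, (hG _ _ _).2 (Or.inl hx)⟩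
    · exact ⟨_, (hG _ _ _).2 (Or.inr ⟨h1, rfl⟩)⟩
  have hGE : ∀ i s v, v ≤ s → G i s v → E i s v := by
    intro i s v hv h1
    rcases (hG _ _ _).1 h1 with h2 | ⟨_, rfl⟩
    · exact h2
    · exfalso
      refine absurd hv (not_le.2 (lt_of_lt_of_le (lt_add_one s) (le_add_of_nonneg_right zero_le)))
  -- constant positions
  have hconst : ∀ i t0, i < b → (∀ t, t0 ≤ t → Q i t = Q i t0) → ∃ x y z, y < b ∧ F x y ∧
      Q i t0 = h y t0 * b + y ∧ h y t0 = TE.pr x z ∧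
      ∀ t, t0 ≤ t → h y t0 ≤ t → g i t x := by
    intro i t0 hi h1
    obtain ⟨y, hy, h2⟩ := hQ1 i t0 hi
    have h3 : ∀ t, t0 ≤ t → h y t = h y t0 := by
      intro t ht
      obtain ⟨y', hy', h4⟩ := hQ1 i t hi
      rw [h1 t ht, h2] at h4
      obtain ⟨h5, rfl⟩ := c.div_unique hy hy' h4
      exact h5.symm
    obtain ⟨x, z, h4, h5⟩ := hvalid y t0 h3
    refine ⟨x, y, z, hy, h5, h2, h4, fun t ht htp => (hg _ _ _).2 ⟨?_, y, hy, h y t0,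
      c.lt_succ.2 htp, z, c.lt_succ.2 ?_, ?_, h4⟩⟩
    · rw [h1 t ht, h1 (t + 1) (ht.trans (lt_add_one t).le)]
    · rw [h4]; exact c.pr_right _ _
    · rw [h1 t ht, h2]
  have hlim : ∀ i t0, i < b → (∀ t, t0 ≤ t → Q i t = Q i t0) → ∃ s1, t0 ≤ s1 ∧ ∀ j, j ≤ i →
      ∃ x y, y < b ∧ F x y ∧ Q j s1 = h y s1 * b + y ∧ ∀ t, s1 ≤ t → G j t x := by
    intro i t0 hi h1
    have hQle : ∀ j t, j ≤ i → t0 ≤ t → Q j t ≤ Q i t0 := by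
      intro j t hj ht
      rcases hj.lt_or_eq with h2 | rfl
      · rw [← h1 t ht]; exact (hQ2 j i t h2 hi).le
      · rw [h1 t ht]
    obtain ⟨f, hf⟩ : ∃ f : M → M → M → M, ∀ p t j, f p t j = Q j t := ⟨_, fun _ _ _ => rfl⟩
    have hfd : DF n (fun e => f (e 0) (e 1) (e 2)) := by
      simp only [hf]
      exact c.F2 hQd (c.var _) (c.var _)
    obtain ⟨s0, hs0, h2⟩ := c.stab_mono (T := fun t => Sum f 0 t (i + 1))
      (c.F3 (c.sum_def hfd) (c.const _) (c.var _) (c.const _)) t0 ((i + 1) * Q i t0)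
      (fun s t _ hst => c.sum_le hfd (k := i + 1) (fun j hj => by
        rw [hf, hf]; exact hQ3 j s t ((c.le_of hj).trans_lt hi) hst) _ le_rfl)
      (fun t ht => c.sum_bound hfd (fun j hj => by rw [hf]; exact hQle j t (c.le_of hj) ht))
    have h3 : ∀ j, j ≤ i → ∀ t, s0 ≤ t → Q j t = Q j s0 := by
      intro j hj t ht
      have := c.sum_eq_imp hfd (p := 0) (q := s0) (p' := 0) (q' := t) (k := i + 1) (fun j hj => by
        rw [hf, hf]; exact hQ3 j s0 t ((c.le_of hj).trans_lt hi) ht) (h2 t ht).symm j (c.lt_succ.2 hj)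
      rw [hf, hf] at this
      exact this.symm
    obtain ⟨s1, hs1⟩ : ∃ s1, s1 = s0 + Q i t0 := ⟨_, rfl⟩
    have hs01 : s0 ≤ s1 := hs1 ▸ le_add_of_nonneg_right zero_le
    have hqs1 : Q i t0 ≤ s1 := hs1 ▸ le_add_of_nonneg_left zero_le
    have h4 : ∀ j, j ≤ i → ∀ t, s1 ≤ t → Q j t = Q j s1 := fun j hj t ht => by
      rw [h3 j hj t (hs01.trans ht), h3 j hj s1 hs01]
    have hb1 : 1 ≤ b := by
      have := c.succ_le ((zero_le (a := i)).trans_lt hi)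
      rwa [zero_add] at this
    have h5 : ∀ j, j ≤ i → ∃ x y, y < b ∧ F x y ∧ Q j s1 = h y s1 * b + y ∧
        ∀ t, s1 ≤ t → g j t x := by
      intro j hj
      obtain ⟨x, y, z, hy, hF, h6, _, h7⟩ := hconst j s1 (hj.trans_lt hi) (h4 j hj)
      refine ⟨x, y, hy, hF, h6, fun t ht => h7 t ht (le_trans ?_ (hqs1.trans ht))⟩
      calc h y s1 ≤ h y s1 * b := le_mul_of_one_le_right zero_le hb1
        _ ≤ h y s1 * b + y := le_add_of_nonneg_right zero_le
        _ = Q j s1 := h6.symm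
        _ ≤ _ := hQle j s1 hj (hs0.trans hs01)
    refine ⟨s1, hs0.trans hs01, fun j hj => ?_⟩
    obtain ⟨x, y, hy, hF, h6, h7⟩ := h5 j hj
    refine ⟨x, y, hy, hF, h6, fun t ht => (hG _ _ _).2 (Or.inl ((hE _ _ _).2 ⟨h7 t ht, ?_⟩))⟩
    intro j' hj' hg'
    obtain ⟨x', y', hy', hF', h6', h7'⟩ := h5 j' (hj'.le.trans hj)
    obtain rfl := hgu _ _ _ _ hg' (h7' t ht)
    obtain rfl := hFfun _ _ _ hF hF'
    exact absurd (hQ2 j' j s1 hj' (hj.trans_lt hi)) (by rw [h6, h6']; exact lt_irrefl _)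
  have hev : ∀ i x, (∃ s, ∀ t, s < t → G i t x) → ∃ t0, ∀ t, t0 ≤ t → Q i t = Q i t0 := by
    rintro i x ⟨s, h1⟩
    obtain ⟨t0, ht0⟩ : ∃ t0, t0 = s + 1 + x := ⟨_, rfl⟩
    have h2 : ∀ t, t0 ≤ t → Q i t = Q i (t + 1) := by
      intro t ht
      have h3 : s < t := lt_of_lt_of_le (lt_add_one s) (le_trans (by
        rw [ht0]; exact le_add_of_nonneg_right zero_le) ht)
      have h4 : x ≤ t := le_trans (by rw [ht0]; exact le_add_of_nonneg_left zero_le) ht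
      exact ((hg _ _ _).1 ((hE _ _ _).1 (hGE i t x h4 (h1 t h3))).1).1
    have h3 : ∀ d, Q i (t0 + d) = Q i t0 := by
      refine c.dind (P := fun d => Q i (t0 + d) = Q i t0)
        (c.eq (c.F2 hQd (c.const _) (c.add (c.const _) (c.var _))) (c.const _)) (by rw [add_zero]) ?_
      intro d ih
      rw [← add_assoc, ← h2 _ (le_add_of_nonneg_right zero_le), ih]
    refine ⟨t0, fun t ht => ?_⟩
    obtain ⟨d, rfl⟩ := exists_add_of_le ht
    exact h3 d
  refine ⟨G, hGd, ?_, ?_, ?_, ?_, ?_⟩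
  · intro i s _
    obtain ⟨v, hv⟩ := hGex i s
    exact ⟨v, hv, fun w hw => hGu _ _ _ _ hw hv⟩
  · intro s i i' v _ _ h1 h2
    rcases (hG _ _ _).1 h1 with h3 | ⟨h3, h3'⟩
    · rcases (hG _ _ _).1 h2 with h4 | ⟨h4, h4'⟩
      · rcases lt_trichotomy i i' with h5 | h5 | h5
        · exact absurd ((hE _ _ _).1 h3).1 (((hE _ _ _).1 h4).2 i h5)
        · exact h5
        · exact absurd ((hE _ _ _).1 h4).1 (((hE _ _ _).1 h3).2 i' h5)
      · exfalso
        have := hEb _ _ _ h3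
        rw [h4'] at this
        exact absurd this (not_lt.2 (le_add_of_nonneg_right zero_le))
    · rcases (hG _ _ _).1 h2 with h4 | ⟨h4, h4'⟩
      · exfalso
        have := hEb _ _ _ h4
        rw [h3'] at this
        exact absurd this (not_lt.2 (le_add_of_nonneg_right zero_le))
      · exact add_left_cancel (h3'.symm.trans h4')
  · intro x
    constructor
    · rintro ⟨y, hF⟩
      obtain ⟨s0, h1⟩ := hvalid2 x y hF
      obtain ⟨i, hi, s1, hs1, h2⟩ := hQ4 y s0 (hFbd x y hF) h1
      obtain ⟨s2, hs2, h3⟩ := hlim i s1 hi (fun t ht => by rw [h2 t ht, h2 s1 le_rfl])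
      obtain ⟨x', y', hy', hF', h4, h5⟩ := h3 i le_rfl
      rw [h2 s2 hs2] at h4
      obtain ⟨_, rfl⟩ := c.div_unique (hFbd x y hF) hy' h4
      obtain rfl := hFinj _ _ _ hF hF'
      exact ⟨i, hi, s2, fun t ht => h5 t ht.le⟩
    · rintro ⟨i, hi, hx⟩
      obtain ⟨t0, ht0⟩ := hev i x hx
      obtain ⟨s, h1⟩ := hx
      obtain ⟨s2, hs2, h3⟩ := hlim i t0 hi ht0
      obtain ⟨x', y', hy', hF', h4, h5⟩ := h3 i le_rfl
      have h6 := h5 (s2 + (s + 1)) (le_add_of_nonneg_right zero_le)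
      have h7 := h1 (s2 + (s + 1)) (lt_of_lt_of_le (lt_add_one s) (le_add_of_nonneg_left zero_le))
      rw [hGu _ _ _ _ h7 h6]
      exact ⟨y', hF'⟩
  · intro i x hi hx
    obtain ⟨t0, ht0⟩ := hev i x hx
    obtain ⟨s2, hs2, h3⟩ := hlim i t0 hi ht0
    refine ⟨s2, fun j hj t ht v w hv hw => ?_⟩
    obtain ⟨x', y', hy', hF', h4, h5⟩ := h3 j hj
    rw [hGu _ _ _ _ hv (h5 s2 le_rfl), hGu _ _ _ _ hw (h5 t ht.le)]
  · rintro i j hj hi ⟨x, hx⟩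
    obtain ⟨t0, ht0⟩ := hev i x hx
    obtain ⟨s2, hs2, h3⟩ := hlim i t0 hi ht0
    obtain ⟨x', y', hy', hF', h4, h5⟩ := h3 j hj
    exact ⟨x', s2, fun t ht => h5 t ht.le⟩

end main

end TE


set_option linter.unusedSectionVars false
set_option linter.unusedVariables false

namespace TE

open FirstOrder Language ArithFC

section interface

variable {M : Type} [lang.Structure M]

theorem funMap_two (F : Func 2) (v : Fin 2 → M) :
    Structure.funMap (L := lang) F v = Structure.funMap (L := lang) F ![v 0, v 1] := by
  congr 1
  funext i
  fin_cases i <;> rfl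

theorem tm_of_term {α : Type} {j : ℕ} (t : lang.Term (α ⊕ Fin j)) {f : α → (ℕ → M) → M}
    {g : Fin j → (ℕ → M) → M} (hf : ∀ a, Tm (f a)) (hg : ∀ i, Tm (g i)) :
    Tm (fun e => t.realize (Sum.elim (fun a => f a e) (fun i => g i e))) := by
  induction t with
  | var a => 
    rcases a with a | i
    · exact hf a
    · exact hg i
  | @func l F ts ih => 
    simp only [Term.realize_func]
    cases F with
    | zero =>
      have : ∀ e : ℕ → M, Structure.funMap (L := lang) Func.zero
          (fun i => (ts i).realize (Sum.elim (fun a => f a e) (fun i => g i e))) = (0 : M) := by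
        intro e
        exact congrArg _ (Subsingleton.elim _ _)
      rw [show (fun e : ℕ → M => Structure.funMap (L := lang) Func.zero
          (fun i => (ts i).realize (Sum.elim (fun a => f a e) (fun i => g i e)))) = fun _ => (0 : M)
          from funext this]
      exact Tm.const _
    | one =>
      have : ∀ e : ℕ → M, Structure.funMap (L := lang) Func.one
          (fun i => (ts i).realize (Sum.elim (fun a => f a e) (fun i => g i e))) = (1 : M) := by
        intro e
        exact congrArg _ (Subsingleton.elim _ _)
      rw [show (fun e : ℕ → M => Structure.funMap (L := lang) Func.one
          (fun i => (ts i).realize (Sum.elim (fun a => f a e) (fun i => g i e)))) = fun _ => (1 : M)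
          from funext this]
      exact Tm.const _
    | add =>
      exact (congrArg Tm (funext fun e => funMap_two Func.add _)).mpr (Tm.add (ih 0) (ih 1))
    | mul =>
      exact (congrArg Tm (funext fun e => funMap_two Func.mul _)).mpr (Tm.mul (ih 0) (ih 1))

/-- extend a list of polynomial functions by a new first variable -/
def sn {j : ℕ} (g : Fin j → (ℕ → M) → M) : Fin (j + 1) → (ℕ → M) → M :=
  Fin.snoc (α := fun _ => (ℕ → M) → M) (fun i e => g i (fun k => e (k + 1))) (fun e => e 0)

theorem sn_tm {j : ℕ} {g : Fin j → (ℕ → M) → M} (hg : ∀ i, Tm (g i)) : ∀ i, Tm (sn g i) := by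
  intro i
  refine Fin.lastCases ?_ (fun i => ?_) i
  · rw [sn, Fin.snoc_last]; exact Tm.var 0
  · rw [sn, Fin.snoc_castSucc]; exact (hg i).tail

theorem sn_cons {j : ℕ} (g : Fin j → (ℕ → M) → M) (x : M) (e : ℕ → M) :
    (fun i => sn g i (cons x e)) = Fin.snoc (α := fun _ => M) (fun i => g i e) x := by
  funext i
  refine Fin.lastCases ?_ (fun i => ?_) i
  · rw [sn, Fin.snoc_last, Fin.snoc_last]; rfl
  · rw [sn, Fin.snoc_castSucc, Fin.snoc_castSucc]; rfl

theorem realize_lift {α : Type} {j : ℕ} (t : lang.Term (α ⊕ Fin j)) (v : α → M) (xs : Fin j → M)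
    (x : M) : (t.liftAt 1 j).realize (Sum.elim v (Fin.snoc (α := fun _ => M) xs x)) =
      t.realize (Sum.elim v xs) := by
  rw [Term.realize_liftAt]
  congr 1
  funext a
  rcases a with a | i
  · rfl
  · simp only [Function.comp, Sum.map_inr, Sum.elim_inr, i.2, if_true]
    exact Fin.snoc_castSucc (α := fun _ => M) x xs i

theorem realize_ltFm {α : Type} {j : ℕ} (t u : lang.Term (α ⊕ Fin j)) (v : α → M) (xs : Fin j → M) :
    (ltFm t u).Realize v xs ↔ t.realize (Sum.elim v xs) < u.realize (Sum.elim v xs) := by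
  have : (fun i => (![t, u] i).realize (Sum.elim v xs)) =
      ![t.realize (Sum.elim v xs), u.realize (Sum.elim v xs)] := by
    funext i
    fin_cases i <;> rfl
  exact Iff.of_eq (congrArg (Structure.RelMap (L := lang) (M := M) Rel.lt) this)

theorem d0_of_delta0 {α : Type} {j : ℕ} {φ : lang.BoundedFormula α j} (h : IsDelta0 j φ) :
    ∀ {f : α → (ℕ → M) → M} {g : Fin j → (ℕ → M) → M}, (∀ a, Tm (f a)) → (∀ i, Tm (g i)) →
      D0 (fun e => φ.Realize (fun a => f a e) (fun i => g i e)) := by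
  induction h with
  | falsum j => intro f g hf hg; exact D0.falsum
  | equal j t u => 
    intro f g hf hg
    exact D0.equal (tm_of_term t hf hg) (tm_of_term u hf hg)
  | rel j l R ts => 
    intro f g hf hg
    cases R
    have hts : ts = ![ts 0, ts 1] := by
      funext i
      fin_cases i <;> rfl
    rw [hts]
    have := D0.lt (tm_of_term (ts 0) hf hg) (tm_of_term (ts 1) hf hg)
    have h2 : ∀ e, (ltFm (ts 0) (ts 1)).Realize (fun a => f a e) (fun i => g i e) ↔ _ :=
      fun e => realize_ltFm (ts 0) (ts 1) (fun a => f a e) (fun i => g i e)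
    have h3 := funext fun e => propext (h2 e)
    rw [← h3] at this
    exact this
  | imp j _ _ h1 h2 => 
    intro f g hf hg
    exact D0.imp (h1 hf hg) (h2 hf hg)
  | @bdAll j t φ _ ih => 
    intro f g hf hg
    have := D0.ball (tm_of_term t hf hg) (ih (f := fun a e => f a (fun k => e (k + 1)))
      (fun a => (hf a).tail) (sn_tm hg))
    simp only [sn_cons, cons_succ] at this
    simp only [BoundedFormula.realize_all, BoundedFormula.realize_imp, realize_ltFm, realize_lift,
      Term.realize_var, Sum.elim_inr, Fin.snoc_last]
    exact this

mutual
theorem sg_of_sigma {α : Type} : ∀ {m j : ℕ} {φ : lang.BoundedFormula α j}, SigmaFm m j φ →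
    ∀ (f : α → (ℕ → M) → M) (g : Fin j → (ℕ → M) → M), (∀ a, Tm (f a)) → (∀ i, Tm (g i)) →
      Sg m (fun e => φ.Realize (fun a => f a e) (fun i => g i e))
  | _, _, _, .delta0 _ _ h => fun f g hf hg => Sg.d0 (d0_of_delta0 h hf hg)
  | _, _, _, .ofPi _ _ h => fun f g hf hg => (Sg.neg (sg_of_pi h f g hf hg)).congr fun e => not_not.symm
  | _, _, _, .ex _ _ h => fun f g hf hg => by
    have := Sg.ex (sg_of_sigma h (fun a e => f a (fun k => e (k + 1))) (sn g)
      (fun a => (hf a).tail) (sn_tm hg))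
    simp only [sn_cons, cons_succ] at this
    simp only [BoundedFormula.realize_ex]
    exact this
theorem sg_of_pi {α : Type} : ∀ {m j : ℕ} {φ : lang.BoundedFormula α j}, PiFm m j φ →
    ∀ (f : α → (ℕ → M) → M) (g : Fin j → (ℕ → M) → M), (∀ a, Tm (f a)) → (∀ i, Tm (g i)) →
      Sg m (fun e => ¬ φ.Realize (fun a => f a e) (fun i => g i e))
  | _, _, _, .delta0 _ _ h => fun f g hf hg => Sg.d0 (d0_of_delta0 h hf hg).not
  | _, _, _, .ofSigma _ _ h => fun f g hf hg => Sg.neg (sg_of_sigma h f g hf hg)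
  | _, _, _, .all _ _ h => fun f g hf hg => by
    have := Sg.ex (sg_of_pi h (fun a e => f a (fun k => e (k + 1))) (sn g)
      (fun a => (hf a).tail) (sn_tm hg))
    simp only [sn_cons, cons_succ] at this
    simp only [BoundedFormula.realize_all, not_forall]
    exact this
end

/-- all parameters in `Pm` are available as free variables -/
def Avail {α : Type} (V : Set (α → M)) (Pm : Finset M) : Prop :=
  ∀ a, a ∈ Pm → ∃ i : α, ∀ v ∈ V, v i = a

open Classical in
theorem term_of_tm {f : (ℕ → M) → M} (hf : Tm f) : ∃ Pm : Finset M, ∀ (α : Type) (V : Set (α → M)),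
    Avail V Pm → ∀ (j : ℕ) (σ : ℕ → lang.Term (α ⊕ Fin j)), ∃ t : lang.Term (α ⊕ Fin j),
      ∀ v ∈ V, ∀ xs : Fin j → M, t.realize (Sum.elim v xs) =
        f (fun i => (σ i).realize (Sum.elim v xs)) := by
  induction hf with
  | var i => exact ⟨∅, fun α V _ j σ => ⟨σ i, fun _ _ _ => rfl⟩⟩
  | const a => 
    refine ⟨{a}, fun α V hV j σ => ?_⟩
    obtain ⟨i, hi⟩ := hV a (Finset.mem_singleton_self a)
    exact ⟨Term.var (Sum.inl i), fun v hv xs => hi v hv⟩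
  | add _ _ h1 h2 => 
    obtain ⟨P1, h1⟩ := h1
    obtain ⟨P2, h2⟩ := h2
    refine ⟨P1 ∪ P2, fun α V hV j σ => ?_⟩
    obtain ⟨t1, h1⟩ := h1 α V (fun a ha => hV a (Finset.mem_union_left _ ha)) j σ
    obtain ⟨t2, h2⟩ := h2 α V (fun a ha => hV a (Finset.mem_union_right _ ha)) j σ
    refine ⟨Term.func (L := lang) (l := 2) Func.add ![t1, t2], fun v hv xs => ?_⟩
    exact (funMap_two Func.add _).trans
      (congrArg₂ (fun x y : M => x + y) (h1 v hv xs) (h2 v hv xs))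
  | mul _ _ h1 h2 => 
    obtain ⟨P1, h1⟩ := h1
    obtain ⟨P2, h2⟩ := h2
    refine ⟨P1 ∪ P2, fun α V hV j σ => ?_⟩
    obtain ⟨t1, h1⟩ := h1 α V (fun a ha => hV a (Finset.mem_union_left _ ha)) j σ
    obtain ⟨t2, h2⟩ := h2 α V (fun a ha => hV a (Finset.mem_union_right _ ha)) j σ
    refine ⟨Term.func (L := lang) (l := 2) Func.mul ![t1, t2], fun v hv xs => ?_⟩
    exact (funMap_two Func.mul _).trans
      (congrArg₂ (fun x y : M => x * y) (h1 v hv xs) (h2 v hv xs))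

/-- substitution under a binder, for formal terms -/
def lf {α : Type} {j : ℕ} (σ : ℕ → lang.Term (α ⊕ Fin j)) : ℕ → lang.Term (α ⊕ Fin (j + 1))
  | 0 => Term.var (Sum.inr (Fin.last j))
  | i + 1 => (σ i).liftAt 1 j

theorem realize_lf {α : Type} {j : ℕ} (σ : ℕ → lang.Term (α ⊕ Fin j)) (v : α → M) (xs : Fin j → M)
    (x : M) : (fun i => (lf σ i).realize (Sum.elim v (Fin.snoc (α := fun _ => M) xs x))) =
      cons x (fun i => (σ i).realize (Sum.elim v xs)) := by
  funext i
  cases i with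
  | zero => simp [lf]
  | succ i => exact realize_lift _ _ _ _

open Classical in
theorem delta0_of_d0 {P : (ℕ → M) → Prop} (hP : D0 P) : ∃ Pm : Finset M,
    ∀ (α : Type) (V : Set (α → M)),
    Avail V Pm → ∀ (j : ℕ) (σ : ℕ → lang.Term (α ⊕ Fin j)), ∃ φ : lang.BoundedFormula α j,
      IsDelta0 j φ ∧ ∀ v ∈ V, ∀ xs : Fin j → M, φ.Realize v xs ↔
        P (fun i => (σ i).realize (Sum.elim v xs)) := by
  induction hP with
  | falsum => exact ⟨∅, fun α V _ j σ => ⟨_, IsDelta0.falsum j, fun _ _ _ => Iff.rfl⟩⟩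
  | equal h1 h2 => 
    obtain ⟨P1, h1⟩ := term_of_tm h1
    obtain ⟨P2, h2⟩ := term_of_tm h2
    refine ⟨P1 ∪ P2, fun α V hV j σ => ?_⟩
    obtain ⟨t1, h1⟩ := h1 α V (fun a ha => hV a (Finset.mem_union_left _ ha)) j σ
    obtain ⟨t2, h2⟩ := h2 α V (fun a ha => hV a (Finset.mem_union_right _ ha)) j σ
    refine ⟨_, IsDelta0.equal j t1 t2, fun v hv xs => ?_⟩
    beta_reduce
    rw [← h1 v hv xs, ← h2 v hv xs]
    exact Iff.rfl
  | lt h1 h2 => 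
    obtain ⟨P1, h1⟩ := term_of_tm h1
    obtain ⟨P2, h2⟩ := term_of_tm h2
    refine ⟨P1 ∪ P2, fun α V hV j σ => ?_⟩
    obtain ⟨t1, h1⟩ := h1 α V (fun a ha => hV a (Finset.mem_union_left _ ha)) j σ
    obtain ⟨t2, h2⟩ := h2 α V (fun a ha => hV a (Finset.mem_union_right _ ha)) j σ
    refine ⟨ltFm t1 t2, IsDelta0.rel j 2 _ _, fun v hv xs => ?_⟩
    beta_reduce
    rw [← h1 v hv xs, ← h2 v hv xs]
    exact realize_ltFm _ _ _ _
  | imp _ _ h1 h2 => 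
    obtain ⟨P1, h1⟩ := h1
    obtain ⟨P2, h2⟩ := h2
    refine ⟨P1 ∪ P2, fun α V hV j σ => ?_⟩
    obtain ⟨t1, d1, h1⟩ := h1 α V (fun a ha => hV a (Finset.mem_union_left _ ha)) j σ
    obtain ⟨t2, d2, h2⟩ := h2 α V (fun a ha => hV a (Finset.mem_union_right _ ha)) j σ
    refine ⟨_, IsDelta0.imp j d1 d2, fun v hv xs => ?_⟩
    beta_reduce
    rw [← h1 v hv xs, ← h2 v hv xs]
    exact Iff.rfl
  | ball h1 _ h2 => 
    obtain ⟨P1, h1⟩ := term_of_tm h1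
    obtain ⟨P2, h2⟩ := h2
    refine ⟨P1 ∪ P2, fun α V hV j σ => ?_⟩
    obtain ⟨t1, h1⟩ := h1 α V (fun a ha => hV a (Finset.mem_union_left _ ha)) j σ
    obtain ⟨t2, d2, h2⟩ := h2 α V (fun a ha => hV a (Finset.mem_union_right _ ha)) (j + 1) (lf σ)
    refine ⟨_, IsDelta0.bdAll j t1 d2, fun v hv xs => ?_⟩
    simp only [BoundedFormula.realize_all, BoundedFormula.realize_imp, realize_ltFm, realize_lift,
      Term.realize_var, Sum.elim_inr, Fin.snoc_last]
    refine forall_congr' fun x => ?_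
    rw [h1 v hv xs, h2 v hv _, realize_lf]

theorem sigma_of_sg {m : ℕ} {P : (ℕ → M) → Prop} (hP : Sg m P) : ∃ Pm : Finset M,
    ∀ (α : Type) (V : Set (α → M)),
    Avail V Pm → ∀ (j : ℕ) (σ : ℕ → lang.Term (α ⊕ Fin j)), ∃ φ ψ : lang.BoundedFormula α j,
      SigmaFm m j φ ∧ PiFm m j ψ ∧ ∀ v ∈ V, ∀ xs : Fin j → M, (φ.Realize v xs ↔
        P (fun i => (σ i).realize (Sum.elim v xs))) ∧ (ψ.Realize v xs ↔
        ¬ P (fun i => (σ i).realize (Sum.elim v xs))) := by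
  induction hP with
  | d0 h => 
    obtain ⟨P1, h1⟩ := delta0_of_d0 h
    refine ⟨P1, fun α V hV j σ => ?_⟩
    obtain ⟨φ, d1, h1⟩ := h1 α V hV j σ
    refine ⟨φ, φ.imp BoundedFormula.falsum, SigmaFm.delta0 _ _ d1,
      PiFm.delta0 _ _ (IsDelta0.imp _ d1 (IsDelta0.falsum _)), fun v hv xs => ⟨h1 v hv xs, ?_⟩⟩
    rw [← h1 v hv xs]
    exact Iff.rfl
  | neg _ h => 
    obtain ⟨P1, h1⟩ := h
    refine ⟨P1, fun α V hV j σ => ?_⟩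
    obtain ⟨φ, ψ, d1, d2, h1⟩ := h1 α V hV j σ
    exact ⟨ψ, φ, SigmaFm.ofPi _ _ d2, PiFm.ofSigma _ _ d1, fun v hv xs => ⟨(h1 v hv xs).2,
      (h1 v hv xs).1.trans not_not.symm⟩⟩
  | ex _ h => 
    obtain ⟨P1, h1⟩ := h
    refine ⟨P1, fun α V hV j σ => ?_⟩
    obtain ⟨φ, ψ, d1, d2, h1⟩ := h1 α V hV (j + 1) (lf σ)
    refine ⟨φ.ex, ψ.all, SigmaFm.ex _ _ d1, PiFm.all _ _ d2, fun v hv xs => ⟨?_, ?_⟩⟩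
    · rw [BoundedFormula.realize_ex]
      refine exists_congr fun x => ?_
      rw [(h1 v hv _).1, realize_lf]
    · rw [BoundedFormula.realize_all, not_exists]
      refine forall_congr' fun x => ?_
      rw [(h1 v hv _).2, realize_lf]

theorem sigmaDef_of_sg {m : ℕ} {P : (ℕ → M) → Prop} (hP : Sg m P) (k : ℕ) :
    IsSigmaDef m M (k := k + 1) (fun v => P (fun i => if h : i < k + 1 then v ⟨i, h⟩ else v 0)) := by
  obtain ⟨Pm, h⟩ := sigma_of_sg hP
  obtain ⟨w, hw⟩ : ∃ w : Fin Pm.card → M, ∀ a, a ∈ Pm → ∃ i, w i = a :=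
    ⟨fun i => (Pm.equivFin.symm i : M), fun a ha => ⟨Pm.equivFin ⟨a, ha⟩, by simp⟩⟩
  obtain ⟨φ, ψ, d1, _, h1⟩ := h (Fin (k + 1) ⊕ Fin Pm.card)
    {v | ∃ u : Fin (k + 1) → M, v = Sum.elim u w} (by
      intro a ha
      obtain ⟨i, hi⟩ := hw a ha
      refine ⟨Sum.inr i, ?_⟩
      rintro v ⟨u, rfl⟩
      exact hi) 0 (fun i => Term.var (Sum.inl (Sum.inl (if h : i < k + 1 then ⟨i, h⟩ else 0))))
  refine ⟨Pm.card, φ, w, d1, fun v => ?_⟩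
  rw [(h1 _ ⟨v, rfl⟩ _).1]
  beta_reduce
  have : (fun i : ℕ => if h : i < k + 1 then v ⟨i, h⟩ else v 0) = fun i =>
      Term.realize (L := lang) (Sum.elim (Sum.elim v w) finZeroElim)
        (Term.var (Sum.inl (Sum.inl (if h : i < k + 1 then ⟨i, h⟩ else 0)))) := by
    funext i
    simp only [Term.realize_var, Sum.elim_inl]
    split_ifs <;> rfl
  rw [this]

end interface

end TE


set_option linter.unusedSectionVars false
set_option linter.unusedVariables false

namespace TE

section red

variable {M : Type} [CommSemiring M] [LinearOrder M] [IsStrictOrderedRing M]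
  [CanonicallyOrderedAdd M]

theorem Ctx.matrix {n : ℕ} (c : Ctx M n) (F : M → M → Prop)
    (hF : Sg (n + 1) (fun e => F (e 0) (e 1))) :
    ∃ S : M → M → M → M → Prop, Dl n (fun e => S (e 0) (e 1) (e 2) (e 3)) ∧
      ∀ x y, F x y ↔ ∃ z, ∀ u, S x y z u := by
  obtain ⟨R, hR, h1⟩ := hF.nf c.cl
  obtain ⟨m, rfl⟩ : ∃ m, n = m + 1 := ⟨n - 1, (Nat.sub_add_cancel c.pos).symm⟩
  obtain ⟨T, hT, h2⟩ := hR.nf (Cl.all c.disc c.ind m (Nat.le_succ m))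
  refine ⟨fun x y z u => T (cons u (cons z (cons x (fun _ => y)))), ?_, ?_⟩
  · have h : Sg m (fun e : ℕ → M => T (cons (e 3) (cons (e 2) (cons (e 0) (fun _ => e 1))))) := by
      have := hT.subst (σ := fun i e => cons (e 3) (cons (e 2) (cons (e 0) (fun _ => e 1))) i) (by
        intro i
        rcases i with _ | _ | _ | i
        · exact Tm.var 3
        · exact Tm.var 2
        · exact Tm.var 0
        · exact Tm.var 1)
      exact this
    exact ⟨h.succ, Sg.neg h⟩
  · intro x y
    have := h1 (cons x (fun _ => y))
    simp only [h2, not_exists, not_not] at this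
    exact this

end red

section models

open FirstOrder Language ArithFC

variable {M : Type} [lang.Structure M]

/-- The semiring structure on a model of PA⁻. -/
@[reducible] def semi (h : PAm M) : CommSemiring M where
  add := fun x y => x + y
  mul := fun x y => x * y
  zero := 0
  one := 1
  add_assoc := h.add_assoc
  add_comm := h.add_comm
  zero_add := fun x => (h.add_comm _ _).trans (h.add_zero x)
  add_zero := h.add_zero
  mul_assoc := h.mul_assoc
  mul_comm := h.mul_comm
  one_mul := fun x => (h.mul_comm _ _).trans (h.mul_one x)
  mul_one := h.mul_one
  zero_mul := fun x => (h.mul_comm _ _).trans (h.mul_zero x)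
  mul_zero := h.mul_zero
  left_distrib := h.ldistrib
  right_distrib := fun x y z => by
    rw [h.mul_comm, h.ldistrib, h.mul_comm z x, h.mul_comm z y]
  nsmul := nsmulRec
  npow := npowRec

open Classical in
/-- The linear order on a model of PA⁻. -/
@[reducible] noncomputable def lin (h : PAm M) : LinearOrder M where
  le := fun x y => x ≤ y
  lt := fun x y => x < y
  le_refl := fun x => Or.inr rfl
  le_trans := by
    rintro x y z (h1 | rfl) (h2 | rfl)
    · exact Or.inl (h.lt_trans _ _ _ h1 h2)
    · exact Or.inl h1
    · exact Or.inl h2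
    · exact Or.inr rfl
  le_antisymm := by
    rintro x y (h1 | rfl) (h2 | h2)
    · exact absurd (h.lt_trans _ _ _ h1 h2) (h.lt_irrefl _)
    · exact h2.symm
    · rfl
    · rfl
  lt_iff_le_not_ge := by
    intro x y
    constructor
    · intro h1
      refine ⟨Or.inl h1, ?_⟩
      rintro (h2 | rfl)
      · exact h.lt_irrefl _ (h.lt_trans _ _ _ h1 h2)
      · exact h.lt_irrefl _ h1
    · rintro ⟨h1 | rfl, h2⟩
      · exact h1
      · exact absurd (Or.inr rfl) h2
  le_total := by
    intro x y
    rcases h.lt_total x y with h1 | h1 | h1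
    · exact Or.inl (Or.inl h1)
    · exact Or.inl (Or.inr h1)
    · exact Or.inr (Or.inl h1)
  toDecidableLE := fun _ _ => Classical.propDecidable _

theorem model_sor (h : PAm M) : letI := semi h; letI := lin h; IsStrictOrderedRing M := by
  letI := semi h
  letI := lin h
  have hnt : Nontrivial M := ⟨0, 1, fun e => h.lt_irrefl (0 : M) (by
    have := h.zero_lt_one
    rwa [← e] at this)⟩
  have hadd : ∀ x y : M, x ≤ y → ∀ z, x + z ≤ y + z := by
    rintro x y (h1 | rfl) z
    · exact Or.inl (h.add_lt_add _ _ _ h1)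
    · exact Or.inr rfl
  have hlt : ∀ x y z : M, x + z ≤ y + z → x ≤ y := by
    intro x y z h1
    rcases h.lt_total x y with h2 | h2 | h2
    · exact Or.inl h2
    · exact Or.inr h2
    · exact absurd (lt_of_lt_of_le (h.add_lt_add _ _ z h2) h1) (h.lt_irrefl _)
  exact
    { exists_pair_ne := hnt.1
      zero_le_one := Or.inl h.zero_lt_one
      add_le_add_left := fun x y h1 z => hadd x y h1 z
      le_of_add_le_add_left := fun x y z h1 => hlt y z x (by
        rw [h.add_comm y x, h.add_comm z x]; exact h1)
      mul_lt_mul_of_pos_left := fun x hx y z h1 => by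
        have := h.mul_lt_mul _ _ _ h1 hx
        rw [h.mul_comm y, h.mul_comm z] at this
        exact this
      mul_lt_mul_of_pos_right := fun x hx y z h1 => h.mul_lt_mul _ _ _ h1 hx }

theorem model_co (h : PAm M) : letI := semi h; letI := lin h; CanonicallyOrderedAdd M := by
  letI := semi h
  letI := lin h
  have hle : ∀ x y : M, x ≤ x + y := by
    intro x y
    have h0 : (0 : M) + x ≤ y + x := by
      rcases h.zero_le y with h1 | h1
      · exact Or.inl (h.add_lt_add _ _ x h1)
      · exact Or.inr (congrArg (fun t : M => t + x) h1)
    rwa [h.add_comm 0 x, h.add_zero, h.add_comm y x] at h0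
  exact
    { exists_add_of_le := by
        rintro x y (h1 | rfl)
        · obtain ⟨z, hz⟩ := h.sub_exists _ _ h1
          exact ⟨z, hz.symm⟩
        · exact ⟨0, (h.add_zero _).symm⟩
      le_self_add := fun x y => hle x y
      le_add_self := fun x y => by
        have := hle x y
        rwa [h.add_comm x y] at this }

theorem model_disc (h : PAm M) : letI := semi h; letI := lin h; Disc M := by
  letI := semi h
  letI := lin h
  intro x y h1
  rcases h.lt_total x y with h2 | h2 | h2
  · exact Or.inl h2
  · exact Or.inr h2
  · exfalso
    obtain ⟨z, hz⟩ := h.sub_exists _ _ h2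
    have hz0 : (0 : M) < z := by
      rcases h.zero_le z with h3 | h3
      · exact h3
      · subst h3
        rw [h.add_zero] at hz
        subst hz
        exact absurd h2 (h.lt_irrefl _)
    have h4 : y + 1 ≤ x := by
      rw [← hz]
      rcases h.discrete z hz0 with h3 | h3
      · have := h.add_lt_add _ _ y h3
        rw [h.add_comm 1, h.add_comm z] at this
        exact Or.inl this
      · rw [← h3]
    rcases h4 with h4 | h4
    · exact h.lt_irrefl _ (h.lt_trans _ _ _ h1 h4)
    · exact h.lt_irrefl x (h4 ▸ h1)

theorem model_ind (h : PAm M) {n : ℕ} (hI : ISig n M) :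
    letI := semi h; letI := lin h; Ind M n := by
  letI := semi h
  letI := lin h
  intro P hP e h0 h1
  have h2 : Sg n (fun e' : ℕ → M => P (cons (e' 0) e)) := by
    have := hP.subst (σ := fun i e' => cons (e' 0) e i) (by
      intro i
      rcases i with _ | i
      · exact Tm.var 0
      · exact Tm.const (e i))
    exact this
  exact hI {x | P (cons x e)} (sigmaDef_of_sg h2 0) h0 h1

theorem model_main (h : PAm M) {n : ℕ} (hn : 1 ≤ n) (hI : ISig n M) (b : M) (F : M → M → Prop)
    (hFdef : SigmaDef2 (n + 1) M F)
    (hFfun : ∀ x y y', F x y → F x y' → y = y')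
    (hFinj : ∀ x x' y, F x y → F x' y → x = x')
    (hFbd : ∀ x y, F x y → y < b) :
    ∃ G : M → M → M → Prop, SigmaDef3 n M G ∧
      (∀ i s : M, i < b → ∃! v, G i s v) ∧
      (∀ s i i' v : M, i < b → i' < b → G i s v → G i' s v → i = i') ∧
      (∀ x : M, (∃ y, F x y) ↔ ∃ i, i < b ∧ EvLim (fun t v => G i t v) x) ∧
      (∀ i x : M, i < b → EvLim (fun t v => G i t v) x →
        ∃ s : M, ∀ j, j ≤ i → ∀ t, s < t → ∀ v w, G j s v → G j t w → v = w) ∧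
      (∀ i j : M, j ≤ i → i < b → (∃ x, EvLim (fun t v => G i t v) x) →
        ∃ x, EvLim (fun t v => G j t v) x) := by
  obtain ⟨p, φ, w, hφ, hF⟩ := hFdef
  have h1 := sg_of_sigma hφ (M := M) (Sum.elim (fun i e => e i) (fun i _ => w i)) (fun i => i.elim0)
    (by
      rintro (i | i)
      · exact Tm.var i
      · exact Tm.const (w i)) (fun i => i.elim0)
  have h2 : Sg (n + 1) (fun e : ℕ → M => F (e 0) (e 1)) := by
    refine h1.congr fun e => (hF ![e 0, e 1]).trans (iff_of_eq ?_)
    congr 1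
    · funext a
      rcases a with i | i
      · fin_cases i <;> rfl
      · rfl
    · exact Subsingleton.elim _ _
  letI i1 := semi h
  letI i2 := lin h
  haveI i3 : IsStrictOrderedRing M := model_sor h
  haveI i4 : CanonicallyOrderedAdd M := model_co h
  have c : Ctx M n := ⟨model_disc h, model_ind h hI, hn⟩
  obtain ⟨S, hS, hFS⟩ := c.matrix F h2
  obtain ⟨G, hG, hG'⟩ := c.main b F S hS hFS hFfun hFinj hFbd
  exact ⟨G, sigmaDef_of_sg hG 2, hG'⟩

end models

end TE


namespace ArithFC

/-- tame enumeration lemma: if `F` is a Σ_{n+1}-definable partial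
injection with range bounded by `b` in a model of PA⁻ + IΣn, then there is a
Σ_n-definable `G : [0,b) × M → M` which (1) is injective in its first argument,
(2) enumerates `dom F` in the limit, and (3) converges in an initial-segment-wise
manner (so the set of `i < b` where the limit exists is downward closed). -/
theorem statement_6 (n : ℕ) (hn : 1 ≤ n) (M : Type) [lang.Structure M]
    (hPA : PAm M) (hI : ISig n M) (b : M) (F : M → M → Prop)
    (hFdef : SigmaDef2 (n + 1) M F)
    (hFfun : ∀ x y y', F x y → F x y' → y = y')
    (hFinj : ∀ x x' y, F x y → F x' y → x = x')
    (hFbd : ∀ x y, F x y → y < b) :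
    ∃ G : M → M → M → Prop, SigmaDef3 n M G ∧
      (∀ i s : M, i < b → ∃! v, G i s v) ∧
      (∀ s i i' v : M, i < b → i' < b → G i s v → G i' s v → i = i') ∧
      (∀ x : M, (∃ y, F x y) ↔ ∃ i, i < b ∧ EvLim (fun t v => G i t v) x) ∧
      (∀ i x : M, i < b → EvLim (fun t v => G i t v) x →
        ∃ s : M, ∀ j, j ≤ i → ∀ t, s < t → ∀ v w, G j s v → G j t w → v = w) ∧
      (∀ i j : M, j ≤ i → i < b → (∃ x, EvLim (fun t v => G i t v) x) →
        ∃ x, EvLim (fun t v => G j t v) x) := by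
  exact TE.model_main hPA hn hI b F hFdef hFfun hFinj hFbd

end ArithFC
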